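/- arXiv:2401.06029 — 5 statements merged into one kernel-verified Lean document; each statement's English description precedes it below -/
import Mathlib

section
/- Let G be an r-graph (r ≥ 1) with maximum degree Δ, and let E_1, …, E_n be the color classes of an edge-coloring of G. If Σ_{i∈I} |E_i| ≥ rΔ(|I|−1)+1 for every subset I ⊆ {1,…,n}, then G has a full rainbow matching with respect to E_1, …, E_n. -/
open Finset

/-- The degree of a vertex `v` in the multi-hypergraph with edge family `E`
(edges indexed by `ι`, parallel edges counted as distinct). -/
def mhDeg {V ι : Type} [Fintype ι] [DecidableEq V] (E : ι → Finset V) (v : V) : ℕ :=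
  (Finset.univ.filter fun a => v ∈ E a).card

/-- The size of the color class of color `i` under the edge-coloring `c`. -/
def classSize {ι κ : Type} [Fintype ι] [DecidableEq κ] (c : ι → κ) (i : κ) : ℕ :=
  (Finset.univ.filter fun a => c a = i).card

/-- An edge-coloring is proper if each color class is a matching. -/
def properColoring {V ι κ : Type} (E : ι → Finset V) (c : ι → κ) : Prop :=
  ∀ a b : ι, a ≠ b → c a = c b → Disjoint (E a) (E b)

/-- A full rainbow matching with respect to the coloring `c`: a set of pairwise disjoint
edges containing exactly one edge from each color class. -/
def hasFullRainbowMatching {V ι κ : Type} (E : ι → Finset V) (c : ι → κ) : Prop :=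
  ∃ f : κ → ι, (∀ i, c (f i) = i) ∧ ∀ i j : κ, i ≠ j → Disjoint (E (f i)) (E (f j))

/-- The sign with which `a` enters the ordered set `insert a s`. -/
noncomputable def insertSign {α : Type} [LinearOrder α] (a : α) (s : Finset α) : ℝ :=
  (-1) ^ (s.filter fun x => x < a).card

section Sign

variable {α : Type} [LinearOrder α]

theorem insertSign_mul_self (a : α) (s : Finset α) : insertSign a s * insertSign a s = 1 := by
  unfold insertSign
  rw [← mul_pow]
  simp

theorem insertSign_insert_of_lt {a b : α} {s : Finset α} (hb : b ∉ s) (h : b < a) :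
    insertSign a (insert b s) = -insertSign a s := by
  unfold insertSign
  rw [Finset.filter_insert, if_pos h, Finset.card_insert_of_notMem (by simp [hb]), pow_succ]
  ring

theorem insertSign_insert_of_not_lt {a b : α} {s : Finset α} (h : ¬ b < a) :
    insertSign a (insert b s) = insertSign a s := by
  unfold insertSign
  rw [Finset.filter_insert, if_neg h]

theorem insertSign_anticomm {a b : α} {s : Finset α} (hab : a ≠ b) (ha : a ∉ s) (hb : b ∉ s) :
    insertSign a (insert b s) * insertSign b s = -(insertSign b (insert a s) * insertSign a s) := by
  rcases lt_or_gt_of_ne hab with h | h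
  · rw [insertSign_insert_of_not_lt h.not_gt, insertSign_insert_of_lt ha h]
    ring
  · rw [insertSign_insert_of_lt hb h, insertSign_insert_of_not_lt h.not_gt]
    ring

theorem insertSign_insert_mul_insertSign_insert {a b : α} {s : Finset α} (hab : a ≠ b)
    (ha : a ∉ s) (hb : b ∉ s) :
    insertSign a (insert b s) * insertSign b (insert a s) = -(insertSign a s * insertSign b s) := by
  rcases lt_or_gt_of_ne hab with h | h
  · rw [insertSign_insert_of_not_lt h.not_gt, insertSign_insert_of_lt ha h]
    ring
  · rw [insertSign_insert_of_lt hb h, insertSign_insert_of_not_lt h.not_gt]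
    ring

end Sign

theorem sum_sum_erase_eq_zero_of_antisymm {α M : Type*} [DecidableEq α] [AddCommGroup M]
    [IsAddTorsionFree M] (s : Finset α) (G : α → α → M)
    (h : ∀ u ∈ s, ∀ v ∈ s, u ≠ v → G u v = -G v u) :
    ∑ u ∈ s, ∑ v ∈ s.erase u, G u v = 0 := by
  have h1 : ∑ u ∈ s, ∑ v ∈ s.erase u, G u v = ∑ v ∈ s, ∑ u ∈ s.erase v, G u v := by
    apply Finset.sum_comm'
    intro x y
    simp only [Finset.mem_erase]
    tauto
  have h2 : ∑ v ∈ s, ∑ u ∈ s.erase v, G u v = -∑ u ∈ s, ∑ v ∈ s.erase u, G u v := by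
    rw [← Finset.sum_neg_distrib]
    refine Finset.sum_congr rfl fun v hv => ?_
    rw [← Finset.sum_neg_distrib]
    refine Finset.sum_congr rfl fun u hu => ?_
    exact h u (Finset.mem_of_mem_erase hu) v hv (Finset.ne_of_mem_erase hu)
  exact self_eq_neg.1 (h1.trans h2)

/-- Pairs (set, element outside) correspond to pairs (set, element inside). -/
theorem sum_sum_compl_eq_sum_sum_erase {ι M : Type*} [Fintype ι] [DecidableEq ι]
    [AddCommMonoid M] (g : Finset ι → ι → M) :
    ∑ ρ, ∑ u ∈ ρᶜ, g ρ u = ∑ σ : Finset ι, ∑ u ∈ σ, g (σ.erase u) u := by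
  rw [Finset.sum_sigma', Finset.sum_sigma']
  refine Finset.sum_bij' (fun x _ => ⟨insert x.2 x.1, x.2⟩) (fun x _ => ⟨x.1.erase x.2, x.2⟩)
    ?_ ?_ ?_ ?_ ?_
  · simp
  · simp
  · rintro ⟨ρ, u⟩ h
    simp at h
    simp [h]
  · rintro ⟨ρ, u⟩ h
    simp at h
    simp [h]
  · rintro ⟨ρ, u⟩ h
    simp at h
    simp [h]

theorem sum_sum_sum_erase_eq {ι M : Type*} [Fintype ι] [DecidableEq ι]
    [AddCommMonoid M] (h : Finset ι → ι → ι → M) :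
    ∑ τ : Finset ι, ∑ u ∈ τ, ∑ w ∈ τ.erase u, h τ u w =
      ∑ ρ : Finset ι, ∑ u ∈ ρᶜ, ∑ w ∈ ρᶜ.erase u, h (insert u (insert w ρ)) u w := by
  have h1 : ∑ τ : Finset ι, ∑ u ∈ τ, ∑ w ∈ τ.erase u, h τ u w =
      ∑ σ : Finset ι, ∑ u ∈ σᶜ, ∑ w ∈ σ, h (insert u σ) u w := by
    rw [sum_sum_compl_eq_sum_sum_erase fun σ u => ∑ w ∈ σ, h (insert u σ) u w]
    refine Finset.sum_congr rfl fun τ _ => Finset.sum_congr rfl fun u hu => ?_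
    rw [Finset.insert_erase hu]
  have h2 : ∑ σ : Finset ι, ∑ u ∈ σᶜ, ∑ w ∈ σ, h (insert u σ) u w =
      ∑ σ : Finset ι, ∑ w ∈ σ, ∑ u ∈ (insert w (σ.erase w))ᶜ,
        h (insert u (insert w (σ.erase w))) u w := by
    refine Finset.sum_congr rfl fun σ _ => ?_
    rw [Finset.sum_comm]
    refine Finset.sum_congr rfl fun w hw => ?_
    rw [Finset.insert_erase hw]
  rw [h1, h2, ← sum_sum_compl_eq_sum_sum_erase
    fun ρ w => ∑ u ∈ (insert w ρ)ᶜ, h (insert u (insert w ρ)) u w]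
  refine Finset.sum_congr rfl fun ρ _ => Finset.sum_comm' fun x y => ?_
  simp only [Finset.mem_compl, Finset.mem_insert, Finset.mem_erase]
  tauto

section Boundary

variable {ι : Type} [Fintype ι] [LinearOrder ι]

/-- The simplicial boundary operator (augmented by the empty simplex) on real chains, viewed as
functions on all finite sets. -/
noncomputable def boundary : (Finset ι → ℝ) →ₗ[ℝ] (Finset ι → ℝ) where
  toFun φ ρ := ∑ u ∈ ρᶜ, insertSign u ρ * φ (insert u ρ)
  map_add' φ ψ := by
    ext ρ
    simp [mul_add, Finset.sum_add_distrib]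
  map_smul' a φ := by
    ext ρ
    simp [Finset.mul_sum, mul_left_comm]

theorem boundary_apply (φ : Finset ι → ℝ) (ρ : Finset ι) :
    boundary φ ρ = ∑ u ∈ ρᶜ, insertSign u ρ * φ (insert u ρ) := rfl

theorem boundary_boundary (φ : Finset ι → ℝ) : boundary (boundary φ) = 0 := by
  ext ρ
  have h : boundary (boundary φ) ρ = ∑ u ∈ ρᶜ, ∑ w ∈ ρᶜ.erase u,
      insertSign u ρ * (insertSign w (insert u ρ) * φ (insert w (insert u ρ))) := by
    rw [boundary_apply]
    refine Finset.sum_congr rfl fun u hu => ?_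
    rw [boundary_apply, Finset.mul_sum, Finset.compl_insert]
  rw [h, Pi.zero_apply]
  apply sum_sum_erase_eq_zero_of_antisymm
  intro u hu v hv huv
  rw [Finset.insert_comm v u]
  have := insertSign_anticomm huv (Finset.mem_compl.1 hu) (Finset.mem_compl.1 hv)
  linear_combination (φ (insert u (insert v ρ))) * this

theorem dotProduct_boundary (y z : Finset ι → ℝ) :
    boundary y ⬝ᵥ z = ∑ τ, y τ * ∑ u ∈ τ, insertSign u (τ.erase u) * z (τ.erase u) := by
  have h := sum_sum_compl_eq_sum_sum_erase
    fun (ρ : Finset ι) u => insertSign u ρ * y (insert u ρ) * z ρ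
  simp only [dotProduct, boundary_apply, Finset.sum_mul, Finset.mul_sum]
  rw [h]
  refine Finset.sum_congr rfl fun τ _ => Finset.sum_congr rfl fun u hu => ?_
  rw [Finset.insert_erase hu]
  ring

end Boundary

theorem exists_add_dotProduct_eq_zero {J : Type*} [Fintype J] (K : Submodule ℝ (J → ℝ))
    (x : J → ℝ) : ∃ k ∈ K, ∃ z, x = k + z ∧ ∀ k' ∈ K, k' ⬝ᵥ z = 0 := by
  let e := (WithLp.linearEquiv 2 ℝ (J → ℝ)).symm
  obtain ⟨k, hk, z, hz, h⟩ := (K.map e.toLinearMap).exists_add_mem_mem_orthogonal (e x)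
  obtain ⟨k, hk, rfl⟩ := hk
  refine ⟨k, hk, e.symm z, ?_, fun k' hk' => ?_⟩
  · apply e.injective
    simpa using h
  · have := (Submodule.mem_orthogonal _ _).1 hz (e k') (Submodule.mem_map_of_mem hk')
    rw [EuclideanSpace.inner_eq_star_dotProduct] at this
    rw [dotProduct_comm]
    simpa [e] using this

section Matching

variable {V ι : Type}

/-- `σ` is a matching consisting of edges indexed by `S`. -/
def IsMatchingIn (E : ι → Finset V) (S σ : Finset ι) : Prop :=
  σ ⊆ S ∧ ∀ a ∈ σ, ∀ b ∈ σ, a ≠ b → Disjoint (E a) (E b)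

theorem IsMatchingIn.mono {E : ι → Finset V} {S σ τ : Finset ι} (h : IsMatchingIn E S τ)
    (hs : σ ⊆ τ) : IsMatchingIn E S σ :=
  ⟨hs.trans h.1, fun a ha b hb => h.2 a (hs ha) b (hs hb)⟩

theorem isMatchingIn_insert_insert [DecidableEq ι] {E : ι → Finset V} {S ρ : Finset ι} {u w : ι}
    (hu : IsMatchingIn E S (insert u ρ)) (hw : IsMatchingIn E S (insert w ρ))
    (h : Disjoint (E u) (E w)) : IsMatchingIn E S (insert u (insert w ρ)) := by
  obtain ⟨h1, h2⟩ := hu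
  obtain ⟨h3, h4⟩ := hw
  refine ⟨Finset.insert_subset (h1 (Finset.mem_insert_self _ _)) h3, ?_⟩
  have := h.symm
  intro a ha b hb hab
  simp only [Finset.mem_insert] at *
  rcases ha with rfl | rfl | ha <;> rcases hb with rfl | rfl | hb <;> grind

variable [DecidableEq V]

theorem sum_card_inter_le [Fintype ι] {E : ι → Finset V} {r Δ : ℕ} (hcard : ∀ a, (E a).card = r)
    (hdeg : ∀ v, mhDeg E v ≤ Δ) (S : Finset ι) (u : ι) :
    ∑ w ∈ S, (E u ∩ E w).card ≤ r * Δ := by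
  calc ∑ w ∈ S, (E u ∩ E w).card ≤ ∑ w, (E u ∩ E w).card :=
        Finset.sum_le_sum_of_subset (Finset.subset_univ S)
    _ = ∑ w, ∑ v ∈ E u, if v ∈ E w then 1 else 0 := by
        simp_rw [← Finset.filter_mem_eq_inter, Finset.card_filter]
    _ = ∑ v ∈ E u, mhDeg E v := by
        rw [Finset.sum_comm]
        simp_rw [mhDeg, Finset.card_filter]
    _ ≤ ∑ v ∈ E u, Δ := Finset.sum_le_sum fun v _ => hdeg v
    _ = r * Δ := by simp [hcard]

theorem sum_sum_card_inter_mul_nonneg (E : ι → Finset V) (S : Finset ι)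
    (ψ : ι → ℝ) : 0 ≤ ∑ u ∈ S, ∑ w ∈ S, ((E u ∩ E w).card : ℝ) * (ψ u * ψ w) := by
  let U := S.biUnion E
  have h : ∑ u ∈ S, ∑ w ∈ S, ((E u ∩ E w).card : ℝ) * (ψ u * ψ w) =
      ∑ v ∈ U, (∑ u ∈ S, if v ∈ E u then ψ u else 0) ^ 2 := by
    simp_rw [sq, Finset.sum_mul_sum]
    rw [Finset.sum_comm]
    rw [Finset.sum_comm (s := U)]
    rw [Finset.sum_comm]
    refine Finset.sum_congr rfl fun u hu => ?_
    rw [Finset.sum_comm (s := U)]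
    refine Finset.sum_congr rfl fun w hw => ?_
    have h1 : E u ∩ E w = U.filter fun v => v ∈ E u ∧ v ∈ E w := by
      ext v
      simp only [Finset.mem_inter, Finset.mem_filter, U, Finset.mem_biUnion]
      exact ⟨fun h => ⟨⟨u, hu, h.1⟩, h⟩, fun h => h.2⟩
    rw [h1, Finset.card_filter, Nat.cast_sum, Finset.sum_mul]
    refine Finset.sum_congr rfl fun v _ => ?_
    by_cases h1 : v ∈ E u <;> by_cases h2 : v ∈ E w <;> simp [h1, h2]
  rw [h]
  positivity

/-- The number of edges in `S` meeting the edge `u`. -/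
def meetCount (E : ι → Finset V) (S : Finset ι) (u : ι) : ℕ :=
  (S.filter fun w => ¬ Disjoint (E u) (E w)).card

theorem sum_meet_mul_ge [Fintype ι] {E : ι → Finset V} {r Δ : ℕ}
    (hcard : ∀ a, (E a).card = r) (hdeg : ∀ v, mhDeg E v ≤ Δ) (S : Finset ι) (ψ : ι → ℝ) :
    ∑ u ∈ S, ((meetCount E S u : ℝ) - r * Δ) * ψ u ^ 2 ≤
      ∑ u ∈ S, ∑ w ∈ S, if Disjoint (E u) (E w) then 0 else ψ u * ψ w := by
  let D : ι → ι → ℝ := fun u w =>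
    (E u ∩ E w).card - if Disjoint (E u) (E w) then 0 else 1
  have hD0 : ∀ u w, 0 ≤ D u w := by
    intro u w
    by_cases h : Disjoint (E u) (E w)
    · simp [D, h]
    · have : 1 ≤ (E u ∩ E w).card := by
        rw [Nat.one_le_iff_ne_zero, Finset.card_ne_zero, ← Finset.not_disjoint_iff_nonempty_inter]
        exact h
      have : (1 : ℝ) ≤ (E u ∩ E w).card := by exact_mod_cast this
      simp only [D, h, if_false]
      linarith
  have hDs : ∀ u w, D u w = D w u := by
    intro u w
    simp only [D, Finset.inter_comm (E u), disjoint_comm (a := E u)]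
  have h1 : ∑ u ∈ S, ∑ w ∈ S, D u w * (ψ u * ψ w) ≤ ∑ u ∈ S, ∑ w ∈ S, D u w * ψ u ^ 2 := by
    have h2 : ∑ u ∈ S, ∑ w ∈ S, D u w * ψ w ^ 2 = ∑ u ∈ S, ∑ w ∈ S, D u w * ψ u ^ 2 := by
      rw [Finset.sum_comm]
      simp_rw [hDs]
    have h3 : ∑ u ∈ S, ∑ w ∈ S, D u w * (ψ u * ψ w) ≤
        ∑ u ∈ S, ∑ w ∈ S, (D u w * ψ u ^ 2 / 2 + D u w * ψ w ^ 2 / 2) := by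
      refine Finset.sum_le_sum fun u _ => Finset.sum_le_sum fun w _ => ?_
      nlinarith [mul_nonneg (hD0 u w) (sq_nonneg (ψ u - ψ w))]
    simp_rw [Finset.sum_add_distrib, ← Finset.sum_div] at h3
    rw [h2] at h3
    linarith
  have h4 : ∑ u ∈ S, ∑ w ∈ S, D u w * ψ u ^ 2 ≤
      ∑ u ∈ S, ((r : ℝ) * Δ - meetCount E S u) * ψ u ^ 2 := by
    refine Finset.sum_le_sum fun u _ => ?_
    rw [← Finset.sum_mul]
    refine mul_le_mul_of_nonneg_right ?_ (sq_nonneg _)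
    have h5 : ((∑ w ∈ S, (E u ∩ E w).card : ℕ) : ℝ) ≤ ((r * Δ : ℕ) : ℝ) :=
      Nat.cast_le.2 (sum_card_inter_le hcard hdeg S u)
    have h6 : (meetCount E S u : ℝ) = ∑ w ∈ S, if Disjoint (E u) (E w) then (0 : ℝ) else 1 := by
      simp [meetCount, Finset.card_filter, ite_not]
    rw [h6]
    push_cast at h5
    simp only [D, Finset.sum_sub_distrib]
    linarith
  have h7 : ∑ u ∈ S, ∑ w ∈ S, (if Disjoint (E u) (E w) then 0 else ψ u * ψ w) =
      ∑ u ∈ S, ∑ w ∈ S, ((E u ∩ E w).card : ℝ) * (ψ u * ψ w) -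
      ∑ u ∈ S, ∑ w ∈ S, D u w * (ψ u * ψ w) := by
    simp_rw [← Finset.sum_sub_distrib]
    refine Finset.sum_congr rfl fun u _ => Finset.sum_congr rfl fun w _ => ?_
    simp only [D]
    split_ifs <;> ring
  have h8 : ∑ u ∈ S, ((meetCount E S u : ℝ) - r * Δ) * ψ u ^ 2 =
      -∑ u ∈ S, ((r : ℝ) * Δ - meetCount E S u) * ψ u ^ 2 := by
    rw [← Finset.sum_neg_distrib]
    exact Finset.sum_congr rfl fun u _ => by ring
  have h9 := sum_sum_card_inter_mul_nonneg E S ψ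
  linarith

end Matching

theorem sum_sum_eq_sum_sum_univ {ι : Type} [Fintype ι] {P : ι → ι → ℝ} {A : Finset ι}
    {B : ι → Finset ι} (h : ∀ u w, P u w ≠ 0 → u ∈ A ∧ w ∈ B u) :
    ∑ u ∈ A, ∑ w ∈ B u, P u w = ∑ u, ∑ w, P u w := by
  have h1 : ∀ u, ∑ w ∈ B u, P u w = ∑ w, P u w := fun u =>
    Finset.sum_subset (Finset.subset_univ _) fun w _ hw => by
      by_contra h0
      exact hw (h u w h0).2
  simp_rw [h1]
  refine Finset.sum_subset (Finset.subset_univ _) fun u _ hu => Finset.sum_eq_zero fun w _ => ?_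
  by_contra h0
  exact hu (h u w h0).1

theorem sq_sum_eq_sum_sq_add {α : Type} [DecidableEq α] (s : Finset α) (a : α → ℝ) :
    (∑ u ∈ s, a u) ^ 2 = ∑ u ∈ s, a u ^ 2 + ∑ u ∈ s, ∑ w ∈ s.erase u, a u * a w := by
  rw [sq, Finset.sum_mul_sum, ← Finset.sum_add_distrib]
  refine Finset.sum_congr rfl fun u hu => ?_
  rw [← Finset.add_sum_erase s _ hu, sq]

/-- Chains of matchings in `S` with exactly `m` edges. -/
def matchingChains {V ι : Type} (E : ι → Finset V) (S : Finset ι) (m : ℕ) : Submodule ℝ (Finset ι → ℝ) where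
  carrier := {y | ∀ σ, y σ ≠ 0 → IsMatchingIn E S σ ∧ σ.card = m}
  add_mem' {x y} hx hy σ h := by
    by_cases h0 : x σ = 0
    · exact hy σ fun h1 => h (by simp [h0, h1])
    · exact hx σ h0
  zero_mem' σ h := absurd rfl h
  smul_mem' a x hx σ h := hx σ fun h0 => h (by simp [h0])

theorem matchingChains_mono {V ι : Type} {E : ι → Finset V} {S T : Finset ι} (h : S ⊆ T) (m : ℕ) :
    matchingChains E S m ≤ matchingChains E T m :=
  fun _ hx σ h0 => ⟨⟨(hx σ h0).1.1.trans h, (hx σ h0).1.2⟩, (hx σ h0).2⟩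

section Laplacian

variable {V ι : Type} [Fintype ι] [LinearOrder ι]

open scoped Classical in
theorem card_le_card_link_add_sum_meetCount [DecidableEq V] {E : ι → Finset V} {S σ : Finset ι}
    (hE : ∀ a, (E a).Nonempty) (hσ : IsMatchingIn E S σ) :
    S.card ≤ (σᶜ.filter fun w => IsMatchingIn E S (insert w σ)).card +
      ∑ u ∈ σ, meetCount E S u := by
  have h : S ⊆ (σᶜ.filter fun w => IsMatchingIn E S (insert w σ)) ∪
      σ.biUnion fun u => S.filter fun w => ¬ Disjoint (E u) (E w) := by
    intro w hw
    by_cases hm : ∃ u ∈ σ, ¬ Disjoint (E u) (E w)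
    · obtain ⟨u, hu, huw⟩ := hm
      exact Finset.mem_union_right _
        (Finset.mem_biUnion.2 ⟨u, hu, Finset.mem_filter.2 ⟨hw, huw⟩⟩)
    · push Not at hm
      refine Finset.mem_union_left _ (Finset.mem_filter.2 ⟨?_, ?_, ?_⟩)
      · rw [Finset.mem_compl]
        intro hws
        exact (hE w).ne_empty (disjoint_self.1 (hm w hws))
      · exact Finset.insert_subset hw hσ.1
      · intro a ha b hb hab
        rcases Finset.mem_insert.1 ha with h1 | ha <;>
          rcases Finset.mem_insert.1 hb with h2 | hb
        · exact absurd (h1.trans h2.symm) hab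
        · exact h1 ▸ (hm b hb).symm
        · exact h2 ▸ hm a ha
        · exact hσ.2 a ha b hb hab
  calc S.card ≤ _ := Finset.card_le_card h
    _ ≤ _ := Finset.card_union_le _ _
    _ ≤ _ := Nat.add_le_add_left Finset.card_biUnion_le _

open scoped Classical in
/-- A chain of `m`-edge matchings which is both a cycle and a cocycle vanishes as soon as there
are more than `r * Δ * m` edges. -/
theorem eq_zero_of_harmonic [DecidableEq V] {E : ι → Finset V} {r Δ m : ℕ} (hr : 1 ≤ r)
    (hcard : ∀ a, (E a).card = r) (hdeg : ∀ v, mhDeg E v ≤ Δ) {S : Finset ι}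
    (hS : r * Δ * m < S.card) {z : Finset ι → ℝ}
    (hz : ∀ σ, z σ ≠ 0 → IsMatchingIn E S σ ∧ σ.card = m) (hb : boundary z = 0)
    (hd : ∀ τ, IsMatchingIn E S τ →
      ∑ u ∈ τ, insertSign u (τ.erase u) * z (τ.erase u) = 0) : z = 0 := by
  have hE : ∀ a, (E a).Nonempty := fun a => Finset.card_pos.1 (by rw [hcard]; exact hr)
  let ψ : Finset ι → ι → ℝ := fun ρ u => if u ∈ ρ then 0 else insertSign u ρ * z (insert u ρ)
  have hψ : ∀ ρ u, ψ ρ u ≠ 0 → u ∉ ρ ∧ u ∈ S ∧ IsMatchingIn E S (insert u ρ) := by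
    intro ρ u h
    by_cases hu : u ∈ ρ
    · simp [ψ, hu] at h
    · have h1 : z (insert u ρ) ≠ 0 := by
        intro h0
        simp [ψ, h0] at h
      have h2 := (hz _ h1).1
      exact ⟨hu, h2.1 (Finset.mem_insert_self _ _), h2⟩
  have hψb : ∀ ρ, ∑ u ∈ S, ψ ρ u = 0 := by
    intro ρ
    have h1 : ∑ u ∈ S, ψ ρ u = ∑ u, ψ ρ u :=
      Finset.sum_subset (Finset.subset_univ _) fun u _ hu => by
        by_contra h0
        exact hu (hψ ρ u h0).2.1
    have h2 : ∑ u ∈ ρᶜ, ψ ρ u = ∑ u, ψ ρ u :=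
      Finset.sum_subset (Finset.subset_univ _) fun u _ hu => by
        by_contra h0
        exact hu (Finset.mem_compl.2 (hψ ρ u h0).1)
    rw [h1, ← h2, ← Pi.zero_apply (M := fun _ => ℝ) ρ, ← hb, boundary_apply]
    exact Finset.sum_congr rfl fun u hu => if_neg (Finset.mem_compl.1 hu)
  have hdiag : ∑ τ : Finset ι, ∑ u ∈ τ,
      (if IsMatchingIn E S τ then (insertSign u (τ.erase u) * z (τ.erase u)) ^ 2 else 0) =
      ∑ σ : Finset ι, ((σᶜ.filter fun w => IsMatchingIn E S (insert w σ)).card : ℝ) * z σ ^ 2 := by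
    have h1 := sum_sum_compl_eq_sum_sum_erase fun (ρ : Finset ι) u =>
      if IsMatchingIn E S (insert u ρ) then (insertSign u ρ * z ρ) ^ 2 else 0
    have h2 : ∑ τ : Finset ι, ∑ u ∈ τ,
      (if IsMatchingIn E S τ then (insertSign u (τ.erase u) * z (τ.erase u)) ^ 2 else 0) =
      ∑ τ : Finset ι, ∑ u ∈ τ, if IsMatchingIn E S (insert u (τ.erase u)) then
        (insertSign u (τ.erase u) * z (τ.erase u)) ^ 2 else 0 := by
      refine Finset.sum_congr rfl fun τ _ => Finset.sum_congr rfl fun u hu => ?_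
      rw [Finset.insert_erase hu]
    rw [h2, ← h1]
    refine Finset.sum_congr rfl fun σ _ => ?_
    rw [← Finset.sum_filter, ← nsmul_eq_mul, ← Finset.sum_const]
    refine Finset.sum_congr rfl fun u _ => ?_
    rw [mul_pow, sq (insertSign u σ), insertSign_mul_self, one_mul]
  have hoff : ∑ τ : Finset ι, ∑ u ∈ τ, ∑ w ∈ τ.erase u,
      (if IsMatchingIn E S τ then (insertSign u (τ.erase u) * z (τ.erase u)) *
        (insertSign w (τ.erase w) * z (τ.erase w)) else 0) =
      -∑ ρ : Finset ι, ∑ u ∈ S, ∑ w ∈ S,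
        if Disjoint (E u) (E w) then ψ ρ u * ψ ρ w else 0 := by
    rw [sum_sum_sum_erase_eq, ← Finset.sum_neg_distrib]
    refine Finset.sum_congr rfl fun ρ _ => ?_
    have hP : ∀ u w, (if Disjoint (E u) (E w) then ψ ρ u * ψ ρ w else 0) ≠ 0 →
        Disjoint (E u) (E w) ∧ ψ ρ u ≠ 0 ∧ ψ ρ w ≠ 0 := by
      intro u w h
      by_cases hd : Disjoint (E u) (E w)
      · rw [if_pos hd] at h
        exact ⟨hd, left_ne_zero_of_mul h, right_ne_zero_of_mul h⟩
      · simp [hd] at h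
    rw [sum_sum_eq_sum_sum_univ (A := S) (B := fun _ => S)
        (fun u w h => ⟨(hψ ρ u (hP u w h).2.1).2.1, (hψ ρ w (hP u w h).2.2).2.1⟩),
      ← sum_sum_eq_sum_sum_univ (A := ρᶜ) (B := fun u => ρᶜ.erase u)
        (fun u w h => ⟨Finset.mem_compl.2 (hψ ρ u (hP u w h).2.1).1, Finset.mem_erase.2 ⟨?_,
          Finset.mem_compl.2 (hψ ρ w (hP u w h).2.2).1⟩⟩), ← Finset.sum_neg_distrib]
    · refine Finset.sum_congr rfl fun u hu => ?_
      rw [← Finset.sum_neg_distrib]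
      refine Finset.sum_congr rfl fun w hw => ?_
      rw [Finset.mem_erase, Finset.mem_compl] at hw
      rw [Finset.mem_compl] at hu
      obtain ⟨hwu, hw⟩ := hw
      have e1 : (insert u (insert w ρ)).erase u = insert w ρ :=
        Finset.erase_insert (by simp [hu, hwu.symm])
      have e2 : (insert u (insert w ρ)).erase w = insert u ρ := by
        rw [Finset.insert_comm]
        exact Finset.erase_insert (by simp [hw, hwu])
      have hs := insertSign_insert_mul_insertSign_insert hwu.symm hu hw
      simp only [e1, e2, ψ, if_neg hu, if_neg hw]
      by_cases hzu : z (insert u ρ) = 0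
      · simp [hzu]
      by_cases hzw : z (insert w ρ) = 0
      · simp [hzw]
      by_cases hdis : Disjoint (E u) (E w)
      · rw [if_pos (isMatchingIn_insert_insert (hz _ hzu).1 (hz _ hzw).1 hdis), if_pos hdis]
        linear_combination z (insert w ρ) * z (insert u ρ) * hs
      · rw [if_neg, if_neg hdis, neg_zero]
        intro hm
        exact hdis (hm.2 u (by simp) w (by simp) hwu.symm)
    · rintro rfl
      exact (hE w).ne_empty (disjoint_self.1 (hP w w h).1)
  have hup : ∑ τ : Finset ι, ∑ u ∈ τ,
      (if IsMatchingIn E S τ then (insertSign u (τ.erase u) * z (τ.erase u)) ^ 2 else 0) +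
      ∑ τ : Finset ι, ∑ u ∈ τ, ∑ w ∈ τ.erase u,
      (if IsMatchingIn E S τ then (insertSign u (τ.erase u) * z (τ.erase u)) *
        (insertSign w (τ.erase w) * z (τ.erase w)) else 0) = 0 := by
    rw [← Finset.sum_add_distrib]
    refine Finset.sum_eq_zero fun τ _ => ?_
    by_cases hτ : IsMatchingIn E S τ
    · simp only [if_pos hτ]
      rw [← sq_sum_eq_sum_sq_add, hd τ hτ]
      simp
    · simp [hτ]
  have hdown : ∑ ρ : Finset ι, ∑ u ∈ S, ∑ w ∈ S, ψ ρ u * ψ ρ w = 0 := by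
    refine Finset.sum_eq_zero fun ρ _ => ?_
    rw [← Finset.sum_mul_sum, hψb, zero_mul]
  have hsplit : ∑ ρ : Finset ι, ∑ u ∈ S, ∑ w ∈ S, ψ ρ u * ψ ρ w =
      ∑ ρ : Finset ι, (∑ u ∈ S, ∑ w ∈ S, if Disjoint (E u) (E w) then ψ ρ u * ψ ρ w else 0) +
      ∑ ρ : Finset ι, ∑ u ∈ S, ∑ w ∈ S, if Disjoint (E u) (E w) then 0 else ψ ρ u * ψ ρ w := by
    simp_rw [← Finset.sum_add_distrib]
    refine Finset.sum_congr rfl fun ρ _ => Finset.sum_congr rfl fun u _ =>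
      Finset.sum_congr rfl fun w _ => ?_
    split_ifs <;> simp
  have hmeet : ∑ ρ : Finset ι, ∑ u ∈ S, ((meetCount E S u : ℝ) - r * Δ) * ψ ρ u ^ 2 ≤
      ∑ ρ : Finset ι, ∑ u ∈ S, ∑ w ∈ S, if Disjoint (E u) (E w) then 0 else ψ ρ u * ψ ρ w :=
    Finset.sum_le_sum fun ρ _ => sum_meet_mul_ge hcard hdeg S (ψ ρ)
  have hre : ∑ ρ : Finset ι, ∑ u ∈ S, ((meetCount E S u : ℝ) - r * Δ) * ψ ρ u ^ 2 =
      ∑ σ : Finset ι, ∑ u ∈ σ, ((meetCount E S u : ℝ) - r * Δ) * z σ ^ 2 := by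
    have h1 := sum_sum_compl_eq_sum_sum_erase fun (ρ : Finset ι) u =>
      ((meetCount E S u : ℝ) - r * Δ) * z (insert u ρ) ^ 2
    have h2 : ∑ σ : Finset ι, ∑ u ∈ σ, ((meetCount E S u : ℝ) - r * Δ) * z σ ^ 2 =
        ∑ σ : Finset ι, ∑ u ∈ σ,
          ((meetCount E S u : ℝ) - r * Δ) * z (insert u (σ.erase u)) ^ 2 := by
      refine Finset.sum_congr rfl fun τ _ => Finset.sum_congr rfl fun u hu => ?_
      rw [Finset.insert_erase hu]
    rw [h2, ← h1]
    refine Finset.sum_congr rfl fun ρ _ => ?_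
    have h3 : ∀ u, ((meetCount E S u : ℝ) - r * Δ) * ψ ρ u ^ 2 ≠ 0 → u ∈ S ∧ u ∈ ρᶜ := by
      intro u h
      have h4 : ψ ρ u ≠ 0 := by
        intro h0
        simp [h0] at h
      exact ⟨(hψ ρ u h4).2.1, Finset.mem_compl.2 (hψ ρ u h4).1⟩
    trans ∑ u, ((meetCount E S u : ℝ) - r * Δ) * ψ ρ u ^ 2
    · refine Finset.sum_subset (Finset.subset_univ _) fun u _ hu => ?_
      by_contra h0
      exact hu (h3 u h0).1
    · symm
      trans ∑ u ∈ ρᶜ, ((meetCount E S u : ℝ) - r * Δ) * ψ ρ u ^ 2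
      · refine Finset.sum_congr rfl fun u hu => ?_
        simp only [ψ, if_neg (Finset.mem_compl.1 hu)]
        rw [mul_pow, sq (insertSign u ρ), insertSign_mul_self, one_mul]
      · refine Finset.sum_subset (Finset.subset_univ _) fun u _ hu => ?_
        by_contra h0
        exact hu (h3 u h0).2
  have hlow : ∑ σ : Finset ι, ((S.card : ℝ) - r * Δ * m) * z σ ^ 2 ≤
      ∑ σ : Finset ι, ((σᶜ.filter fun w => IsMatchingIn E S (insert w σ)).card : ℝ) * z σ ^ 2 +
      ∑ σ : Finset ι, ∑ u ∈ σ, ((meetCount E S u : ℝ) - r * Δ) * z σ ^ 2 := by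
    rw [← Finset.sum_add_distrib]
    refine Finset.sum_le_sum fun σ _ => ?_
    by_cases h0 : z σ = 0
    · simp [h0]
    obtain ⟨hm, hc⟩ := hz σ h0
    rw [← Finset.sum_mul, ← add_mul]
    refine mul_le_mul_of_nonneg_right ?_ (sq_nonneg _)
    have h1 : (S.card : ℝ) ≤ ((σᶜ.filter fun w => IsMatchingIn E S (insert w σ)).card : ℝ) +
        ∑ u ∈ σ, (meetCount E S u : ℝ) := by
      exact_mod_cast card_le_card_link_add_sum_meetCount hE hm
    rw [Finset.sum_sub_distrib, Finset.sum_const, hc, nsmul_eq_mul]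
    linarith
  have hpos : (0 : ℝ) < (S.card : ℝ) - r * Δ * m := by
    have : ((r * Δ * m : ℕ) : ℝ) < S.card := Nat.cast_lt.2 hS
    push_cast at this
    linarith
  rw [← Finset.mul_sum] at hlow
  have hzero : ∑ σ : Finset ι, z σ ^ 2 ≤ 0 := by
    by_contra! hlt
    have := mul_pos hpos hlt
    linarith
  ext σ
  have h1 := (Finset.sum_eq_zero_iff_of_nonneg fun σ _ => sq_nonneg (z σ)).1
    (le_antisymm hzero (Finset.sum_nonneg fun σ _ => sq_nonneg (z σ))) σ (Finset.mem_univ σ)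
  simpa using h1

theorem boundary_mem_matchingChains {E : ι → Finset V} {S : Finset ι} {m : ℕ} {y : Finset ι → ℝ}
    (hy : y ∈ matchingChains E S (m + 1)) : boundary y ∈ matchingChains E S m := by
  intro σ h
  obtain ⟨u, hu, h⟩ := Finset.exists_ne_zero_of_sum_ne_zero h
  obtain ⟨h1, h2⟩ := hy _ (right_ne_zero_of_mul h)
  rw [Finset.card_insert_of_notMem (Finset.mem_compl.1 hu)] at h2
  exact ⟨h1.mono (Finset.subset_insert _ _), by omega⟩

/-- Vanishing of the homology of the matching complex. -/
theorem exists_boundary_eq [DecidableEq V] {E : ι → Finset V} {r Δ m : ℕ} (hr : 1 ≤ r)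
    (hcard : ∀ a, (E a).card = r) (hdeg : ∀ v, mhDeg E v ≤ Δ) {S : Finset ι}
    (hS : r * Δ * m < S.card) {x : Finset ι → ℝ} (hx : x ∈ matchingChains E S m)
    (hb : boundary x = 0) : ∃ y ∈ matchingChains E S (m + 1), boundary y = x := by
  obtain ⟨k, hk, z, hxz, hz⟩ :=
    exists_add_dotProduct_eq_zero ((matchingChains E S (m + 1)).map boundary) x
  obtain ⟨y, hy, rfl⟩ := hk
  refine ⟨y, hy, ?_⟩
  have hzx : z = x - boundary y := by
    rw [hxz]
    abel
  have hzm : z ∈ matchingChains E S m := by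
    rw [hzx]
    exact Submodule.sub_mem _ hx (boundary_mem_matchingChains hy)
  have hzb : boundary z = 0 := by
    rw [hzx, map_sub, hb, boundary_boundary, sub_zero]
  have h0 : z = 0 := by
    refine eq_zero_of_harmonic hr hcard hdeg hS hzm hzb fun τ hτ => ?_
    by_cases hc : τ.card = m + 1
    · have h1 : Pi.single τ (1 : ℝ) ∈ matchingChains E S (m + 1) := by
        intro σ h
        obtain rfl : σ = τ := by
          by_contra hne
          exact h (Pi.single_eq_of_ne hne _)
        exact ⟨hτ, hc⟩
      have h2 := hz _ (Submodule.mem_map_of_mem h1)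
      rw [dotProduct_boundary] at h2
      rw [Finset.sum_eq_single τ (fun σ _ h => by rw [Pi.single_eq_of_ne h, zero_mul])
        (by simp), Pi.single_eq_same, one_mul] at h2
      exact h2
    · refine Finset.sum_eq_zero fun u hu => ?_
      have : z (τ.erase u) = 0 := by
        by_contra h0
        have := (hzm _ h0).2
        rw [Finset.card_erase_of_mem hu] at this
        have := Finset.card_pos.2 ⟨u, hu⟩
        omega
      rw [this, mul_zero]
  rw [hxz, h0, add_zero]

end Laplacian

/-- `σ` has exactly one element of each color in `J`, and no others. -/
def IsRainbow {ι κ : Type} [DecidableEq κ] (c : ι → κ) (J : Finset κ) (σ : Finset ι) : Prop :=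
  σ.image c = J ∧ σ.card = J.card

theorem IsRainbow.injOn {ι κ : Type} [DecidableEq κ] {c : ι → κ} {J : Finset κ} {σ : Finset ι} (h : IsRainbow c J σ) :
    Set.InjOn c σ :=
  Finset.card_image_iff.1 (by rw [h.1, h.2])

section Rainbow

variable {ι κ : Type} [LinearOrder ι] [LinearOrder κ]

theorem insertSign_eq_insertSign_image {c : ι → κ} (hc : Monotone c) {u : ι} {ρ : Finset ι}
    (hinj : Set.InjOn c ρ) (hu : ∀ x ∈ ρ, c x ≠ c u) :
    insertSign u ρ = insertSign (c u) (ρ.image c) := by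
  unfold insertSign
  have h : (ρ.image c).filter (fun y => y < c u) = (ρ.filter fun x => x < u).image c := by
    rw [Finset.filter_image]
    congr 1
    refine Finset.filter_congr fun x hx => ⟨fun h => ?_, fun h => ?_⟩
    · exact hc.reflect_lt h
    · exact lt_of_le_of_ne (hc h.le) (hu x hx)
  rw [h, Finset.card_image_of_injOn (hinj.mono fun x hx => (Finset.mem_filter.1 hx).1)]

theorem insertSign_erase_eq_neg {c : ι → κ} (hc : Monotone c) {u v : ι} {σ : Finset ι}
    (hu : u ∈ σ) (hv : v ∈ σ) (huv : u ≠ v) (hcuv : c u = c v) (hinj : Set.InjOn c (σ.erase u)) :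
    insertSign u (σ.erase u) = -insertSign v (σ.erase v) := by
  obtain ⟨ρ, rfl, huρ, hvρ⟩ : ∃ ρ, σ = insert u (insert v ρ) ∧ u ∉ ρ ∧ v ∉ ρ :=
    ⟨(σ.erase u).erase v, by
      rw [Finset.insert_erase (Finset.mem_erase.2 ⟨huv.symm, hv⟩), Finset.insert_erase hu],
      by simp, by simp⟩
  have e1 : (insert u (insert v ρ)).erase u = insert v ρ :=
    Finset.erase_insert (by simp [huρ, huv])
  have e2 : (insert u (insert v ρ)).erase v = insert u ρ := by
    rw [Finset.insert_comm]
    exact Finset.erase_insert (by simp [hvρ, huv.symm])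
  rw [e1] at hinj ⊢
  rw [e2]
  have hinjρ : Set.InjOn c ρ := hinj.mono (by simp)
  have hne : ∀ x ∈ ρ, c x ≠ c v := by
    intro x hx h
    have := hinj (by simp [hx]) (by simp) h
    exact hvρ (this ▸ hx)
  have h1 : insertSign u ρ = insertSign v ρ := by
    rw [insertSign_eq_insertSign_image hc hinjρ hne,
      insertSign_eq_insertSign_image hc hinjρ (hcuv ▸ hne), hcuv]
  have h2 := insertSign_anticomm huv huρ hvρ
  rw [h1] at h2
  have h3 := insertSign_mul_self v ρ
  linear_combination insertSign v ρ * h2 - (insertSign u (insert v ρ) +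
    insertSign v (insert u ρ)) * h3

theorem isRainbow_iff_erase {c : ι → κ} {J : Finset κ} {σ : Finset ι} {u : ι} (hu : u ∈ σ)
    (hJ : c u ∈ J) : IsRainbow c J σ ↔ IsRainbow c (J.erase (c u)) (σ.erase u) := by
  have h1 := Finset.card_erase_add_one hu
  have h2 := Finset.card_erase_add_one hJ
  constructor
  · intro h
    refine ⟨?_, by have := h.2; omega⟩
    ext j
    simp only [Finset.mem_image, Finset.mem_erase]
    constructor
    · rintro ⟨x, ⟨hxu, hx⟩, rfl⟩
      exact ⟨fun he => hxu (h.injOn hx hu he), h.1 ▸ Finset.mem_image_of_mem c hx⟩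
    · rintro ⟨hj, hj'⟩
      rw [← h.1, Finset.mem_image] at hj'
      obtain ⟨x, hx, rfl⟩ := hj'
      exact ⟨x, ⟨fun he => hj (by rw [he]), hx⟩, rfl⟩
  · intro h
    refine ⟨?_, by have := h.2; omega⟩
    rw [← Finset.insert_erase hu, Finset.image_insert, h.1, Finset.insert_erase hJ]

variable [Fintype ι]

open scoped Classical in
theorem sum_rainbow_boundary {c : ι → κ} (hc : Monotone c) {I : Finset κ} {i : κ} (hi : i ∈ I)
    {y : Finset ι → ℝ} (hy : ∀ σ, y σ ≠ 0 → ∀ a ∈ σ, c a ∈ I) :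
    ∑ ρ with IsRainbow c (I.erase i) ρ, boundary y ρ =
      insertSign i (I.erase i) * ∑ σ with IsRainbow c I σ, y σ := by
  have h1 := sum_sum_compl_eq_sum_sum_erase fun (ρ : Finset ι) u =>
    if IsRainbow c (I.erase i) ρ then insertSign u ρ * y (insert u ρ) else 0
  have h2 : ∑ ρ with IsRainbow c (I.erase i) ρ, boundary y ρ =
      ∑ ρ, ∑ u ∈ ρᶜ,
        if IsRainbow c (I.erase i) ρ then insertSign u ρ * y (insert u ρ) else 0 := by
    rw [Finset.sum_filter]
    refine Finset.sum_congr rfl fun ρ _ => ?_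
    split_ifs
    · rfl
    · simp
  rw [h2, h1, Finset.mul_sum, Finset.sum_filter]
  refine Finset.sum_congr rfl fun σ _ => ?_
  by_cases h0 : y σ = 0
  · rw [Finset.sum_eq_zero]
    · simp [h0]
    · intro u hu
      rw [Finset.insert_erase hu, h0]
      simp
  have hcol := hy σ h0
  rw [← Finset.sum_filter]
  by_cases hR : IsRainbow c I σ
  · rw [if_pos hR]
    obtain ⟨u, hu, rfl⟩ := Finset.mem_image.1 (hR.1 ▸ hi)
    have hfil : σ.filter (fun v => IsRainbow c (I.erase (c u)) (σ.erase v)) = {u} := by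
      ext v
      simp only [Finset.mem_filter, Finset.mem_singleton]
      constructor
      · rintro ⟨hv, hv'⟩
        by_contra hne
        have : c u ∈ I.erase (c u) :=
          hv'.1 ▸ Finset.mem_image_of_mem c (Finset.mem_erase.2 ⟨Ne.symm hne, hu⟩)
        simp at this
      · rintro rfl
        exact ⟨hu, (isRainbow_iff_erase hu hi).1 hR⟩
    have hR' := (isRainbow_iff_erase hu hi).1 hR
    rw [hfil, Finset.sum_singleton, Finset.insert_erase hu,
      insertSign_eq_insertSign_image hc hR'.injOn, hR'.1]
    intro x hx
    have hx' := Finset.mem_image_of_mem c hx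
    rw [hR'.1] at hx'
    exact Finset.ne_of_mem_erase hx'
  · rw [if_neg hR]
    by_cases hex : ∃ u ∈ σ, IsRainbow c (I.erase i) (σ.erase u)
    · obtain ⟨u, hu, hRu⟩ := hex
      have hci : c u ≠ i := by
        rintro rfl
        exact hR ((isRainbow_iff_erase hu hi).2 hRu)
      have hmem : c u ∈ (σ.erase u).image c := by
        rw [hRu.1]
        exact Finset.mem_erase.2 ⟨hci, hcol u hu⟩
      obtain ⟨v, hv, hvu⟩ := Finset.mem_image.1 hmem
      obtain ⟨hne, hv⟩ := Finset.mem_erase.1 hv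
      have hRv : IsRainbow c (I.erase i) (σ.erase v) := by
        constructor
        · rw [← hRu.1]
          ext j
          simp only [Finset.mem_image, Finset.mem_erase]
          constructor
          · rintro ⟨x, ⟨hxv, hx⟩, rfl⟩
            by_cases hxu : x = u
            · exact ⟨v, ⟨hne, hv⟩, by rw [hvu, hxu]⟩
            · exact ⟨x, ⟨hxu, hx⟩, rfl⟩
          · rintro ⟨x, ⟨hxu, hx⟩, rfl⟩
            by_cases hxv : x = v
            · exact ⟨u, ⟨hne.symm, hu⟩, by rw [← hvu, hxv]⟩
            · exact ⟨x, ⟨hxv, hx⟩, rfl⟩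
        · rw [← hRu.2, Finset.card_erase_of_mem hu, Finset.card_erase_of_mem hv]
      have hfil : σ.filter (fun w => IsRainbow c (I.erase i) (σ.erase w)) = {u, v} := by
        ext w
        simp only [Finset.mem_filter, Finset.mem_insert, Finset.mem_singleton]
        constructor
        · rintro ⟨hw, hw'⟩
          by_contra! hcon
          exact hne (hw'.injOn (by simp [hv, hcon.2.symm]) (by simp [hu, hcon.1.symm]) hvu)
        · rintro (rfl | rfl)
          · exact ⟨hu, hRu⟩
          · exact ⟨hv, hRv⟩
      rw [hfil, Finset.sum_pair hne.symm, Finset.insert_erase hu, Finset.insert_erase hv,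
        insertSign_erase_eq_neg hc hu hv hne.symm hvu.symm hRu.injOn]
      ring
    · rw [Finset.filter_false_of_mem fun u hu h => hex ⟨u, hu, h⟩, Finset.sum_empty]

end Rainbow

section Main

variable {V ι κ : Type} [Fintype ι] [LinearOrder ι] [LinearOrder κ]

/-- The edges whose color lies in `I`. -/
def colorUnion (c : ι → κ) (I : Finset κ) : Finset ι :=
  Finset.univ.filter fun a => c a ∈ I

/-- A compatible system of chains, one for each set of colors. -/
theorem exists_chain_system [Fintype κ] [DecidableEq V] {E : ι → Finset V} {r Δ : ℕ} (hr : 1 ≤ r)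
    (hcard : ∀ a, (E a).card = r) (hdeg : ∀ v, mhDeg E v ≤ Δ) (c : ι → κ)
    (hS : ∀ (I : Finset κ) m, I.card = m + 1 → r * Δ * m < (colorUnion c I).card) :
    ∃ C : Finset κ → Finset ι → ℝ, C ∅ = Pi.single ∅ 1 ∧ ∀ I,
      C I ∈ matchingChains E (colorUnion c I) I.card ∧
      boundary (C I) = ∑ i ∈ I, insertSign i (I.erase i) • C (I.erase i) := by
  suffices h : ∀ k, ∃ C : Finset κ → Finset ι → ℝ, C ∅ = Pi.single ∅ 1 ∧ ∀ I, I.card ≤ k →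
      C I ∈ matchingChains E (colorUnion c I) I.card ∧
      boundary (C I) = ∑ i ∈ I, insertSign i (I.erase i) • C (I.erase i) by
    obtain ⟨C, h1, h2⟩ := h (Fintype.card κ)
    exact ⟨C, h1, fun I => h2 I (Finset.card_le_univ I)⟩
  intro k
  induction k with
  | zero =>
    refine ⟨fun _ => Pi.single ∅ 1, rfl, fun I hI => ?_⟩
    obtain rfl : I = ∅ := Finset.card_eq_zero.1 (Nat.le_zero.1 hI)
    refine ⟨fun σ h => ?_, ?_⟩
    · obtain rfl : σ = ∅ := by
        by_contra hne
        exact h (Pi.single_eq_of_ne hne _)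
      exact ⟨⟨by simp, by simp⟩, rfl⟩
    · ext ρ
      rw [boundary_apply]
      simp [Pi.single_apply]
  | succ k ih =>
    obtain ⟨C, hC0, hC⟩ := ih
    have hfill : ∀ I : Finset κ, I.card = k + 1 →
        ∃ y ∈ matchingChains E (colorUnion c I) (k + 1),
          boundary y = ∑ i ∈ I, insertSign i (I.erase i) • C (I.erase i) := by
      intro I hI
      have hcI : ∀ i ∈ I, (I.erase i).card = k := fun i hi => by
        rw [Finset.card_erase_of_mem hi, hI, Nat.add_sub_cancel]
      refine exists_boundary_eq hr hcard hdeg (hS I k hI) ?_ ?_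
      · refine Submodule.sum_mem _ fun i hi => Submodule.smul_mem _ _ ?_
        have h1 := (hC (I.erase i) (hcI i hi).le).1
        rw [hcI i hi] at h1
        refine matchingChains_mono ?_ k h1
        intro a ha
        simp only [colorUnion, Finset.mem_filter, Finset.mem_erase] at ha ⊢
        exact ⟨ha.1, ha.2.2⟩
      · rw [map_sum]
        trans ∑ i ∈ I, ∑ j ∈ I.erase i, insertSign i (I.erase i) •
          insertSign j ((I.erase i).erase j) • C ((I.erase i).erase j)
        · refine Finset.sum_congr rfl fun i hi => ?_
          rw [map_smul, (hC (I.erase i) (hcI i hi).le).2, Finset.smul_sum]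
        · refine sum_sum_erase_eq_zero_of_antisymm I _ fun i hi j hj hij => ?_
          rw [smul_smul, smul_smul, Finset.erase_right_comm (a := j), ← neg_smul]
          congr 1
          have h1 := insertSign_anticomm (s := (I.erase i).erase j) hij (by simp) (by simp)
          rw [Finset.insert_erase (Finset.mem_erase.2 ⟨hij.symm, hj⟩),
            Finset.erase_right_comm (a := i),
            Finset.insert_erase (Finset.mem_erase.2 ⟨hij, hi⟩)] at h1
          rw [Finset.erase_right_comm (a := i)]
          linear_combination h1
    choose! F hF1 hF2 using hfill
    have hlt : ∀ I : Finset κ, I.card ≤ k → (if I.card = k + 1 then F I else C I) = C I :=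
      fun I hI => if_neg (by omega)
    refine ⟨fun I => if I.card = k + 1 then F I else C I, ?_, fun I hI => ?_⟩
    · simp only
      rw [hlt ∅ (by simp), hC0]
    · have hsum : ∑ i ∈ I, insertSign i (I.erase i) •
          (if (I.erase i).card = k + 1 then F (I.erase i) else C (I.erase i)) =
          ∑ i ∈ I, insertSign i (I.erase i) • C (I.erase i) := by
        refine Finset.sum_congr rfl fun i hi => ?_
        rw [hlt]
        rw [Finset.card_erase_of_mem hi]
        omega
      simp only
      rw [hsum]
      by_cases hk : I.card = k + 1
      · rw [if_pos hk, hF2 I hk, hk]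
        exact ⟨hF1 I hk, rfl⟩
      · rw [if_neg hk]
        exact hC I (by omega)

open scoped Classical in
theorem exists_isRainbow_isMatchingIn [Fintype κ] [DecidableEq V] {E : ι → Finset V} {r Δ : ℕ}
    (hr : 1 ≤ r) (hcard : ∀ a, (E a).card = r) (hdeg : ∀ v, mhDeg E v ≤ Δ) {c : ι → κ}
    (hc : Monotone c)
    (hS : ∀ (I : Finset κ) m, I.card = m + 1 → r * Δ * m < (colorUnion c I).card) :
    ∃ σ, IsRainbow c Finset.univ σ ∧ IsMatchingIn E Finset.univ σ := by
  obtain ⟨C, hC0, hC⟩ := exists_chain_system hr hcard hdeg c hS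
  have hcol : ∀ I σ, C I σ ≠ 0 → ∀ a ∈ σ, c a ∈ I := by
    intro I σ h a ha
    have := ((hC I).1 σ h).1.1 ha
    simpa [colorUnion] using this
  have key : ∀ I : Finset κ, ∑ σ with IsRainbow c I σ, C I σ = 1 := by
    intro I
    induction I using Finset.induction_on with
    | empty =>
      rw [Finset.sum_eq_single_of_mem ∅ (by simp [IsRainbow]) fun σ _ h => by
        rw [hC0, Pi.single_eq_of_ne h], hC0, Pi.single_eq_same]
    | insert i J hi ih =>
      have hiI : i ∈ insert i J := Finset.mem_insert_self _ _
      have h1 := sum_rainbow_boundary hc hiI (hcol (insert i J))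
      rw [(hC (insert i J)).2] at h1
      simp only [Finset.sum_apply, Pi.smul_apply, smul_eq_mul] at h1
      rw [Finset.sum_comm, Finset.sum_eq_single_of_mem i hiI, ← Finset.mul_sum,
        Finset.erase_insert hi, ih] at h1
      · have h2 := insertSign_mul_self i J
        linear_combination -insertSign i J * h1 -
          (∑ σ with IsRainbow c (insert i J) σ, C (insert i J) σ - 1) * h2
      · intro j hj hji
        refine Finset.sum_eq_zero fun ρ hρ => ?_
        have h0 : C ((insert i J).erase j) ρ = 0 := by
          by_contra h0
          have h2 : j ∈ ρ.image c := by
            rw [(Finset.mem_filter.1 hρ).2.1]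
            exact Finset.mem_erase.2 ⟨hji, hj⟩
          obtain ⟨a, ha, rfl⟩ := Finset.mem_image.1 h2
          have := hcol _ ρ h0 a ha
          simp at this
        rw [h0, mul_zero]
  obtain ⟨σ, hσ, h⟩ := Finset.exists_ne_zero_of_sum_ne_zero
    (show ∑ σ with IsRainbow c Finset.univ σ, C Finset.univ σ ≠ 0 by
      rw [key]
      exact one_ne_zero)
  exact ⟨σ, (Finset.mem_filter.1 hσ).2, Finset.subset_univ σ, ((hC _).1 σ h).1.2⟩

end Main

/-- Theorem of Aharoni, Berger, and Meshulam: if `G` is an `r`-graph with maximum degree `Δ`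
and `Σ_{i ∈ I} |E_i| ≥ rΔ(|I|-1)+1` for every set `I` of colors, then there is a full
rainbow matching. -/
theorem stmt0 {V ι : Type} [Fintype ι] [DecidableEq V]
    (r Δ n : ℕ) (hr : 1 ≤ r)
    (E : ι → Finset V) (hcard : ∀ a, (E a).card = r)
    (hdeg : ∀ v, mhDeg E v ≤ Δ)
    (c : ι → Fin n)
    (hsum : ∀ I : Finset (Fin n),
      (r : ℤ) * (Δ : ℤ) * ((I.card : ℤ) - 1) + 1 ≤ ∑ i ∈ I, (classSize c i : ℤ)) :
    hasFullRainbowMatching E c := by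
  let e := Fintype.equivFin ι
  let _ : LinearOrder ι := LinearOrder.lift' (fun a => toLex (c a, e a)) fun a b h =>
    e.injective (Prod.ext_iff.1 (toLex.injective h)).2
  have hc : Monotone c := fun a b h => Prod.Lex.monotone_fst (toLex (c a, e a)) (toLex (c b, e b)) h
  obtain ⟨σ, hσ, hm⟩ := exists_isRainbow_isMatchingIn hr hcard hdeg hc fun I m hI => by
    have h1 := hsum I
    have h2 : (colorUnion c I).card = ∑ i ∈ I, classSize c i := by
      have h3 : Set.MapsTo c (colorUnion c I) I := fun a ha => (Finset.mem_filter.1 ha).2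
      rw [Finset.card_eq_sum_card_fiberwise h3]
      refine Finset.sum_congr rfl fun i hi => ?_
      unfold classSize colorUnion
      rw [Finset.filter_filter]
      congr 1
      ext a
      simp only [Finset.mem_filter]
      grind
    rw [← Nat.cast_sum, ← h2, hI] at h1
    push_cast at h1
    rw [add_sub_cancel_right] at h1
    exact_mod_cast h1
  have hex : ∀ i, ∃ a ∈ σ, c a = i := fun i =>
    Finset.mem_image.1 (hσ.1 ▸ Finset.mem_univ i)
  choose f hf1 hf2 using hex
  refine ⟨f, hf2, fun i j hij => hm.2 _ (hf1 i) _ (hf1 j) fun h => hij ?_⟩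
  rw [← hf2 i, h, hf2]
end

section
/- For every multigraph H with maximum degree Δ ≥ 2 and chromatic index χ', there exist a multigraph G with maximum degree Δ and chromatic index χ' and a proper edge-coloring of G into color classes E_1, …, E_n such that |E_i| ≥ χ' − 1 for every i and G has no full rainbow matching with respect to E_1, …, E_n. Moreover, if H has at most 2Δ − 1 edges, then such G and color classes exist with |E_i| ≥ χ' for every i. -/
open Finset

/-- The chromatic index of the edge family `E`: the least number of matchings into which
the edge family can be partitioned. -/
def isChromaticIndex {V ι : Type} (E : ι → Finset V) (χ : ℕ) : Prop :=
  IsLeast {k : ℕ | ∃ c : ι → Fin k, properColoring E c} χ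

section Shannon

variable {V ι κ : Type}

/-- The coloring `c` is proper on the edges indexed by `S`. -/
def ProperOn (E : ι → Finset V) (S : Finset ι) (c : ι → κ) : Prop :=
  ∀ a ∈ S, ∀ b ∈ S, a ≠ b → c a = c b → Disjoint (E a) (E b)

/-- No edge of `S` at the vertex `v` has color `γ`. -/
def Missing (E : ι → Finset V) (S : Finset ι) (c : ι → κ) (v : V) (γ : κ) : Prop :=
  ∀ a ∈ S, v ∈ E a → c a ≠ γ

theorem ProperOn.insert_update [DecidableEq ι] {E : ι → Finset V} {S : Finset ι} {c : ι → κ}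
    {e : ι} {γ : κ}
    (h : ProperOn E S c) (he : e ∉ S) (hm : ∀ v ∈ E e, Missing E S c v γ) :
    ProperOn E (insert e S) (Function.update c e γ) := by
  have key : ∀ b ∈ S, c b = γ → Disjoint (E e) (E b) := fun b hb hcb =>
    Finset.disjoint_left.2 fun v hv hvb => hm v hv b hb hvb hcb
  intro a ha b hb hab hc
  rcases Finset.mem_insert.1 ha with rfl | haS <;>
    rcases Finset.mem_insert.1 hb with rfl | hbS
  · exact absurd rfl hab
  · rw [Function.update_self, Function.update_of_ne hab.symm] at hc
    exact key b hbS hc.symm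
  · rw [Function.update_self, Function.update_of_ne hab] at hc
    exact (key a haS hc).symm
  · rw [Function.update_of_ne (by grind), Function.update_of_ne (by grind)] at hc
    exact h a haS b hbS hab hc

/-- `C` is a union of components of the subgraph formed by the edges of `S` colored `β` or `γ`. -/
def KempeClosed (E : ι → Finset V) (S : Finset ι) (c : ι → κ) (β γ : κ) (C : Set V) : Prop :=
  ∀ a ∈ S, c a = β ∨ c a = γ → ∀ u ∈ E a, ∀ v ∈ E a, u ∈ C → v ∈ C

theorem KempeClosed.compl {E : ι → Finset V} {S : Finset ι} {c : ι → κ} {β γ : κ} {C : Set V}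
    (h : KempeClosed E S c β γ C) : KempeClosed E S c β γ Cᶜ :=
  fun a ha hc u hu v hv huC hvC => huC (h a ha hc v hv u hu hvC)

open Classical in
/-- Exchange the colors `β` and `γ` on the edges meeting `C`. -/
noncomputable def kempeSwap (E : ι → Finset V) (c : ι → κ) (β γ : κ) (C : Set V) (a : ι) : κ :=
  if ∃ u ∈ E a, u ∈ C then Equiv.swap β γ (c a) else c a

theorem kempeSwap_of_ne {E : ι → Finset V} {c : ι → κ} {β γ : κ} {C : Set V} {a : ι}
    (hβ : c a ≠ β) (hγ : c a ≠ γ) : kempeSwap E c β γ C a = c a := by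
  classical
  unfold kempeSwap
  split_ifs
  · exact Equiv.swap_apply_of_ne_of_ne hβ hγ
  · rfl

theorem eq_of_kempeSwap_eq {E : ι → Finset V} {c : ι → κ} {β γ δ : κ} {C : Set V} {a : ι}
    (hβ : δ ≠ β) (hγ : δ ≠ γ) (h : kempeSwap E c β γ C a = δ) : c a = δ := by
  classical
  unfold kempeSwap at h
  split_ifs at h
  · rwa [Equiv.swap_apply_eq_iff, Equiv.swap_apply_of_ne_of_ne hβ hγ] at h
  · exact h

theorem kempeSwap_of_mem {E : ι → Finset V} {c : ι → κ} [DecidableEq κ] {β γ : κ} {C : Set V}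
    {a : ι} {v : V} (hv : v ∈ E a) (hC : v ∈ C) :
    kempeSwap E c β γ C a = Equiv.swap β γ (c a) := by
  unfold kempeSwap
  rw [if_pos ⟨v, hv, hC⟩]
  congr!

theorem KempeClosed.kempeSwap_of_notMem {E : ι → Finset V} {S : Finset ι} {c : ι → κ} {β γ : κ}
    {C : Set V} (h : KempeClosed E S c β γ C) {a : ι} {v : V} (ha : a ∈ S) (hv : v ∈ E a)
    (hC : v ∉ C) : kempeSwap E c β γ C a = c a := by
  by_cases hc : c a = β ∨ c a = γ
  · unfold kempeSwap
    rw [if_neg]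
    rintro ⟨u, hu, huC⟩
    exact hC (h a ha hc u hu v hv huC)
  · push Not at hc
    exact kempeSwap_of_ne hc.1 hc.2

theorem KempeClosed.properOn {E : ι → Finset V} {S : Finset ι} {c : ι → κ} {β γ : κ} {C : Set V}
    (h : KempeClosed E S c β γ C) (hp : ProperOn E S c) :
    ProperOn E S (kempeSwap E c β γ C) := by
  classical
  intro a ha b hb hab hc
  by_contra hd
  obtain ⟨v, hva, hvb⟩ := Finset.not_disjoint_iff.1 hd
  refine hd (hp a ha b hb hab ?_)
  by_cases hC : v ∈ C
  · rw [kempeSwap_of_mem hva hC, kempeSwap_of_mem hvb hC] at hc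
    exact (Equiv.swap β γ).injective hc
  · rwa [h.kempeSwap_of_notMem ha hva hC, h.kempeSwap_of_notMem hb hvb hC] at hc

theorem Missing.kempeSwap_of_mem {E : ι → Finset V} {S : Finset ι} {c : ι → κ} [DecidableEq κ]
    {β γ δ : κ} {C : Set V} {v : V} (hv : v ∈ C) (hm : Missing E S c v (Equiv.swap β γ δ)) :
    Missing E S (kempeSwap E c β γ C) v δ := by
  intro a ha hva hc
  rw [_root_.kempeSwap_of_mem hva hv] at hc
  exact hm a ha hva (by rw [← hc, Equiv.swap_apply_self])

theorem KempeClosed.missing_of_notMem {E : ι → Finset V} {S : Finset ι} {c : ι → κ}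
    {β γ δ : κ} {C : Set V} {v : V} (h : KempeClosed E S c β γ C) (hv : v ∉ C)
    (hm : Missing E S c v δ) : Missing E S (kempeSwap E c β γ C) v δ := by
  intro a ha hva hc
  rw [h.kempeSwap_of_notMem ha hva hv] at hc
  exact hm a ha hva hc

/-- The graph joining the ends of the edges of `S` colored `β` or `γ`. -/
def kempeGraph (E : ι → Finset V) (S : Finset ι) (c : ι → κ) (β γ : κ) : SimpleGraph V where
  Adj u v := u ≠ v ∧ ∃ a ∈ S, (c a = β ∨ c a = γ) ∧ u ∈ E a ∧ v ∈ E a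
  symm := ⟨fun _ _ ⟨h, a, ha, hc, hu, hv⟩ => ⟨h.symm, a, ha, hc, hv, hu⟩⟩
  loopless := ⟨fun _ h => h.1 rfl⟩

theorem eq_of_card_two_of_mem {s : Finset V} (hs : s.card = 2) {u v w : V} (hu : u ∈ s)
    (hv : v ∈ s) (hw : w ∈ s) (huv : u ≠ v) (huw : u ≠ w) : v = w := by
  classical
  obtain ⟨x, y, hxy, rfl⟩ := Finset.card_eq_two.1 hs
  simp only [Finset.mem_insert, Finset.mem_singleton] at hu hv hw
  grind

open Classical in
theorem kempeGraph_card_le {E : ι → Finset V} {S : Finset ι} {c : ι → κ} {β γ : κ}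
    (hcard : ∀ a, (E a).card = 2) (hp : ProperOn E S c) (v : V) (N : Finset V)
    (hN : ∀ w ∈ N, (kempeGraph E S c β γ).Adj v w) :
    N.card ≤ (({β, γ} : Finset κ).filter fun δ => ¬ Missing E S c v δ).card := by
  rcases N.eq_empty_or_nonempty with rfl | ⟨w₀, hw₀⟩
  · simp
  have : Nonempty ι := ⟨(hN w₀ hw₀).2.choose⟩
  choose! f hf using fun w hw => (hN w hw).2
  refine Finset.card_le_card_of_injOn (fun w => c (f w)) ?_ ?_
  · intro w hw
    obtain ⟨h1, h2, h3, -⟩ := hf w hw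
    simp only [Finset.coe_filter, Finset.mem_insert, Finset.mem_singleton, Set.mem_ofPred_eq]
    exact ⟨h2, fun hm => hm _ h1 h3 rfl⟩
  · intro w hw w' hw' hc
    obtain ⟨h1, -, h3, h4⟩ := hf w hw
    obtain ⟨h1', -, h3', h4'⟩ := hf w' hw'
    have hff : f w = f w' := by
      by_contra hne
      exact Finset.disjoint_left.1 (hp _ h1 _ h1' hne hc) h3 h3'
    rw [hff] at h4
    exact eq_of_card_two_of_mem (hcard _) h3' h4 h4' (hN w hw).1 (hN w' hw').1

/-- A finite connected graph of maximum degree at most two has at most two vertices of degree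
at most one. -/
theorem SimpleGraph.Connected.not_three_degree_le_one {W : Type} [Fintype W] [DecidableEq W]
    {G : SimpleGraph W} [DecidableRel G.Adj] (hG : G.Connected) (h2 : ∀ v, G.degree v ≤ 2)
    {x y z : W} (hxy : x ≠ y) (hxz : x ≠ z) (hyz : y ≠ z) (hx : G.degree x ≤ 1)
    (hy : G.degree y ≤ 1) (hz : G.degree z ≤ 1) : False := by
  have h1 := hG.card_vert_le_card_edgeSet_add_one
  rw [Nat.card_eq_fintype_card, Nat.card_eq_fintype_card, ← SimpleGraph.edgeFinset_card] at h1
  have hsum := G.sum_degrees_eq_twice_card_edges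
  have h3 : ∑ v, (G.degree v + if v ∈ ({x, y, z} : Finset W) then 1 else 0) ≤ ∑ _v : W, 2 := by
    refine Finset.sum_le_sum fun v _ => ?_
    split_ifs with hv
    · simp only [Finset.mem_insert, Finset.mem_singleton] at hv
      rcases hv with rfl | rfl | rfl <;> omega
    · exact h2 v
  rw [Finset.sum_add_distrib, hsum, Finset.sum_ite_mem, Finset.univ_inter] at h3
  have h4 : ({x, y, z} : Finset W).card = 3 := Finset.card_eq_three.2 ⟨x, y, z, hxy, hxz, hyz, rfl⟩
  simp only [Finset.sum_const, h4, Finset.card_univ, smul_eq_mul] at h3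
  omega

theorem exists_kempeClosed [Fintype V] {E : ι → Finset V} {S : Finset ι} {c : ι → κ} {β γ : κ}
    (hcard : ∀ a, (E a).card = 2) (hp : ProperOn E S c) {x y z : V}
    (hxy : x ≠ y) (hxz : x ≠ z) (hyz : y ≠ z) (hx : Missing E S c x γ) (hy : Missing E S c y β)
    (hz : Missing E S c z γ) :
    ∃ C, KempeClosed E S c β γ C ∧ y ∈ C ∧ (z ∉ C ∨ x ∉ C) := by
  classical
  set G := kempeGraph E S c β γ
  set K := G.connectedComponentMk y with hK
  have hclosed : KempeClosed E S c β γ K.supp := by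
    intro a ha hc u hu v hv huC
    by_cases huv : u = v
    · exact huv ▸ huC
    · have hadj : G.Adj u v := ⟨huv, a, ha, hc, hu, hv⟩
      exact (K.mem_supp_congr_adj hadj).1 huC
  refine ⟨K.supp, hclosed, rfl, ?_⟩
  by_contra! hcon
  have hbound : ∀ v : K.supp, (G.induce K.supp).degree v ≤
      (({β, γ} : Finset κ).filter fun δ => ¬ Missing E S c v δ).card := by
    intro v
    have := kempeGraph_card_le (β := β) (γ := γ) hcard hp (v : V)
      (((G.induce K.supp).neighborFinset v).map (Function.Embedding.subtype _)) (by
        intro w hw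
        simp only [Finset.mem_map, SimpleGraph.mem_neighborFinset] at hw
        obtain ⟨w', hw', rfl⟩ := hw
        exact hw')
    rwa [Finset.card_map] at this
  have h1 : ∀ v : K.supp, Missing E S c v β ∨ Missing E S c v γ →
      (G.induce K.supp).degree v ≤ 1 := by
    intro v hv
    refine (hbound v).trans ?_
    rw [Finset.card_le_one]
    simp only [Finset.mem_filter, Finset.mem_insert, Finset.mem_singleton]
    grind
  have h2 : ∀ v : K.supp, (G.induce K.supp).degree v ≤ 2 := fun v =>
    (hbound v).trans ((Finset.card_filter_le _ _).trans Finset.card_le_two)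
  exact SimpleGraph.Connected.not_three_degree_le_one
    (G := G.induce K.supp) K.connected_toSimpleGraph h2
    (x := ⟨x, hcon.2⟩) (y := ⟨y, rfl⟩) (z := ⟨z, hcon.1⟩)
    (fun h => hxy (congrArg Subtype.val h)) (fun h => hxz (congrArg Subtype.val h))
    (fun h => hyz (congrArg Subtype.val h))
    (h1 _ (.inr hx)) (h1 _ (.inl hy)) (h1 _ (.inr hz))

theorem card_missing [Fintype ι] [DecidableEq V] {k Δ : ℕ} {E : ι → Finset V}
    (hdeg : ∀ v, mhDeg E v ≤ Δ) (S : Finset ι) (c : ι → Fin k) (v : V) :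
    k ≤ {γ | Missing E S c v γ}.ncard + Δ := by
  classical
  have h1 : {γ | Missing E S c v γ}ᶜ ⊆
      (((Finset.univ.filter fun a => v ∈ E a).image c : Finset (Fin k)) : Set (Fin k)) := by
    intro γ hγ
    simp only [Set.mem_compl_iff, Set.mem_ofPred_eq, Missing] at hγ
    push Not at hγ
    obtain ⟨a, -, hv, hc⟩ := hγ
    simpa using ⟨a, hv, hc⟩
  have h2 := Set.ncard_le_ncard h1
  rw [Set.ncard_coe_finset] at h2
  have h3 := Finset.card_image_le (s := Finset.univ.filter fun a => v ∈ E a) (f := c)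
  have h4 := hdeg v
  have h5 := Set.ncard_add_ncard_compl {γ | Missing E S c v γ}
  rw [Nat.card_eq_fintype_card, Fintype.card_fin] at h5
  unfold mhDeg at h4
  omega

theorem card_missing_of_notMem [Fintype ι] [DecidableEq V] {k Δ : ℕ} {E : ι → Finset V}
    (hdeg : ∀ v, mhDeg E v ≤ Δ) {S : Finset ι} (c : ι → Fin k) {v : V} {e : ι} (he : e ∉ S)
    (hv : v ∈ E e) : k + 1 ≤ {γ | Missing E S c v γ}.ncard + Δ := by
  classical
  have h1 : {γ | Missing E S c v γ}ᶜ ⊆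
      ((((Finset.univ.filter fun a => v ∈ E a).erase e).image c : Finset (Fin k)) :
        Set (Fin k)) := by
    intro γ hγ
    simp only [Set.mem_compl_iff, Set.mem_ofPred_eq, Missing] at hγ
    push Not at hγ
    obtain ⟨a, ha, hv, hc⟩ := hγ
    have hae : a ≠ e := fun h => he (h ▸ ha)
    exact mod_cast Finset.mem_image.2 ⟨a, by simp [hae, hv], hc⟩
  have h2 := Set.ncard_le_ncard h1
  rw [Set.ncard_coe_finset] at h2
  have h3 := Finset.card_image_le (s := (Finset.univ.filter fun a => v ∈ E a).erase e) (f := c)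
  have h6 := Finset.card_erase_add_one (s := Finset.univ.filter fun a => v ∈ E a) (a := e)
    (by simpa using hv)
  have h4 := hdeg v
  have h5 := Set.ncard_add_ncard_compl {γ | Missing E S c v γ}
  rw [Nat.card_eq_fintype_card, Fintype.card_fin] at h5
  unfold mhDeg at h4
  omega

theorem ProperOn.exists_insert [Fintype V] [Fintype ι] [DecidableEq V] [DecidableEq ι] {k Δ : ℕ}
    {E : ι → Finset V} (hcard : ∀ a, (E a).card = 2) (hdeg : ∀ v, mhDeg E v ≤ Δ)
    (hk : Δ + Δ / 2 ≤ k) {S : Finset ι} {c : ι → Fin k} (hp : ProperOn E S c) {e : ι}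
    (he : e ∉ S) : ∃ c' : ι → Fin k, ProperOn E (insert e S) c' := by
  by_contra! hN
  obtain ⟨x, y, hxy, hE⟩ := Finset.card_eq_two.1 (hcard e)
  have hxe : x ∈ E e := by simp [hE]
  have hye : y ∈ E e := by simp [hE]
  have no_common : ∀ c' : ι → Fin k, ProperOn E S c' → ∀ γ, Missing E S c' x γ →
      ¬ Missing E S c' y γ := by
    intro c' hc' γ h1 h2
    refine hN _ (hc'.insert_update (γ := γ) he fun v hv => ?_)
    rw [hE, Finset.mem_insert, Finset.mem_singleton] at hv
    rcases hv with rfl | rfl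
    exacts [h1, h2]
  have hMx := card_missing_of_notMem hdeg c he hxe
  have hMy := card_missing_of_notMem hdeg c he hye
  obtain ⟨α, hα⟩ : {γ | Missing E S c x γ}.Nonempty :=
    (Set.ncard_pos).1 (by omega)
  obtain ⟨β, hβ⟩ : {γ | Missing E S c y γ}.Nonempty :=
    (Set.ncard_pos).1 (by omega)
  simp only [Set.mem_ofPred_eq] at hα hβ
  obtain ⟨f, hfS, hyf, hcf⟩ : ∃ f ∈ S, y ∈ E f ∧ c f = α := by
    have := no_common c hp α hα
    unfold Missing at this
    push Not at this
    exact this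
  have hxf : x ∉ E f := fun h => hα f hfS h hcf
  have hfe : f ≠ e := fun h => he (h ▸ hfS)
  obtain ⟨z, hzy, hEf⟩ : ∃ z, z ≠ y ∧ E f = {y, z} := by
    obtain ⟨u, v, huv, h⟩ := Finset.card_eq_two.1 (hcard f)
    rw [h, Finset.mem_insert, Finset.mem_singleton] at hyf
    rcases hyf with rfl | rfl
    · exact ⟨v, huv.symm, h⟩
    · exact ⟨u, huv, by rw [h, Finset.pair_comm]⟩
  have hzf : z ∈ E f := by simp [hEf]
  have hxz : x ≠ z := fun h => hxf (h ▸ hzf)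
  have hMz := card_missing hdeg S c z
  have hαf : ∀ a ∈ S, c a = α → a ≠ f → Disjoint (E f) (E a) := fun a ha hca hne =>
    hp f hfS a ha hne.symm (hcf.trans hca.symm)
  have mem_f : ∀ {P : V → Prop}, P y → P z → ∀ v ∈ E f, P v := by
    intro P h1 h2 v hv
    rw [hEf, Finset.mem_insert, Finset.mem_singleton] at hv
    rcases hv with rfl | rfl
    exacts [h1, h2]
  have hyz_disj : ∀ γ, Missing E S c z γ → ¬ Missing E S c y γ := by
    intro γ hz hy
    have hp' : ProperOn E (insert f (S.erase f)) (Function.update c f γ) := by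
      refine ProperOn.insert_update (fun a ha b hb => hp a (Finset.mem_of_mem_erase ha) b
        (Finset.mem_of_mem_erase hb)) (Finset.notMem_erase f S) ?_
      exact mem_f (fun a ha => hy a (Finset.mem_of_mem_erase ha))
        (fun a ha => hz a (Finset.mem_of_mem_erase ha))
    rw [Finset.insert_erase hfS] at hp'
    refine no_common _ hp' α ?_ ?_
    · intro a ha hxa
      rw [Function.update_of_ne (by rintro rfl; exact hxf hxa)]
      exact hα a ha hxa
    · intro a ha hya
      by_cases haf : a = f
      · subst haf
        rw [Function.update_self]
        rintro rfl
        exact hy a ha hyf hcf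
      · rw [Function.update_of_ne haf]
        exact fun h => Finset.disjoint_left.1 (hαf a ha h haf) hyf hya
  have hxz_disj : ∀ γ, Missing E S c z γ → ¬ Missing E S c x γ := by
    intro γ hz hx
    have hβγ : β ≠ γ := by
      rintro rfl
      exact no_common c hp β hx hβ
    have hγα : γ ≠ α := by
      rintro rfl
      exact hz f hfS hzf hcf
    have hβα : β ≠ α := by
      rintro rfl
      exact hβ f hfS hyf hcf
    have hsub : ∀ {a}, a ∈ S.erase f → a ∈ S := fun h => Finset.mem_of_mem_erase h
    set S' := insert e (S.erase f) with hS'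
    set c₁ := Function.update c e α
    have hc₁e : c₁ e = α := Function.update_self ..
    have hc₁S : ∀ a ∈ S, c₁ a = c a := fun a ha =>
      Function.update_of_ne (by rintro rfl; exact he ha) ..
    have hp₁ : ProperOn E S' c₁ := by
      refine ProperOn.insert_update (fun a ha b hb => hp a (hsub ha) b (hsub hb))
        (fun h => he (hsub h)) fun v hv => ?_
      rw [hE, Finset.mem_insert, Finset.mem_singleton] at hv
      rcases hv with rfl | rfl
      · exact fun a ha => hα a (hsub ha)
      · exact fun a ha hva hca => Finset.disjoint_left.1
          (hαf a (hsub ha) hca (Finset.ne_of_mem_erase ha)) hyf hva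
    have miss : ∀ {v δ}, δ ≠ α → Missing E S c v δ → Missing E S' c₁ v δ := by
      intro v δ hδ h a ha hva
      rcases Finset.mem_insert.1 ha with rfl | ha
      · rw [hc₁e]
        exact hδ.symm
      · rw [hc₁S a (hsub ha)]
        exact h a (hsub ha) hva
    have hfS' : f ∉ S' := by simp [hS', hfe]
    have hins : insert f S' = insert e S := by
      rw [hS', Finset.insert_comm, Finset.insert_erase hfS]
    obtain ⟨C, hC, hyC, hzx⟩ := exists_kempeClosed hcard hp₁ hxy hxz hzy.symm
      (miss hγα hx) (miss hβα hβ) (miss hγα hz)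
    by_cases hzC : z ∈ C
    · have hxC : x ∉ C := by tauto
      have hD := hC.compl
      set c₂ := kempeSwap E c₁ β γ Cᶜ
      have hp₂ : ProperOn E S' c₂ := hD.properOn hp₁
      have hx₂ : Missing E S' c₂ x β :=
        Missing.kempeSwap_of_mem hxC (by simpa using miss hγα hx)
      have hy₂ : Missing E S' c₂ y β := hD.missing_of_notMem (by simpa using hyC) (miss hβα hβ)
      have hp₃ : ProperOn E (insert f (S.erase f)) (Function.update c₂ f α) := by
        refine ProperOn.insert_update (fun a ha b hb => hp₂ a (Finset.mem_insert_of_mem ha) b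
          (Finset.mem_insert_of_mem hb)) (Finset.notMem_erase f S) fun v hv a ha hva hca => ?_
        have hca' : c a = α := by
          rw [← hc₁S a (hsub ha)]
          exact eq_of_kempeSwap_eq hβα.symm hγα.symm hca
        exact Finset.disjoint_left.1 (hαf a (hsub ha) hca' (Finset.ne_of_mem_erase ha)) hv hva
      rw [Finset.insert_erase hfS] at hp₃
      have miss₃ : ∀ {v}, Missing E S' c₂ v β → Missing E S (Function.update c₂ f α) v β := by
        intro v h a ha hva
        by_cases haf : a = f
        · subst haf
          rw [Function.update_self]
          exact hβα.symm
        · rw [Function.update_of_ne haf]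
          exact h a (by simp [hS', ha, haf]) hva
      exact no_common _ hp₃ β (miss₃ hx₂) (miss₃ hy₂)
    · refine hN _ (hins ▸ (hC.properOn hp₁).insert_update (γ := γ) hfS' ?_)
      exact mem_f (Missing.kempeSwap_of_mem hyC (by simpa using miss hβα hβ))
        (hC.missing_of_notMem hzC (miss hγα hz))
  have hd1 : Disjoint {γ | Missing E S c x γ} {γ | Missing E S c y γ} :=
    Set.disjoint_left.2 fun γ h1 h2 => no_common c hp γ h1 h2
  have hd2 : Disjoint ({γ | Missing E S c x γ} ∪ {γ | Missing E S c y γ})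
      {γ | Missing E S c z γ} :=
    Set.disjoint_left.2 fun γ h1 h2 => h1.elim (hxz_disj γ h2) (hyz_disj γ h2)
  have h1 := Set.ncard_union_eq hd2
  rw [Set.ncard_union_eq hd1] at h1
  have h2 := Set.ncard_le_card ({γ | Missing E S c x γ} ∪ {γ | Missing E S c y γ} ∪
      {γ | Missing E S c z γ})
  rw [Nat.card_eq_fintype_card, Fintype.card_fin] at h2
  omega

/-- Shannon's theorem: a multigraph of maximum degree at most `Δ` has a proper edge-coloring with
`⌊3Δ/2⌋` colors. -/
theorem exists_properColoring_of_mhDeg_le [Fintype V] [Fintype ι] [DecidableEq V] {k Δ : ℕ}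
    {E : ι → Finset V} (hcard : ∀ a, (E a).card = 2) (hdeg : ∀ v, mhDeg E v ≤ Δ)
    (hk : Δ + Δ / 2 ≤ k) : ∃ c : ι → Fin k, properColoring E c := by
  classical
  have key : ∀ S : Finset ι, S.Nonempty → ∃ c : ι → Fin k, ProperOn E S c := by
    intro S hS
    have hk0 : 0 < k := by
      obtain ⟨a, -⟩ := hS
      obtain ⟨v, hv⟩ : (E a).Nonempty := Finset.card_pos.1 (by rw [hcard]; norm_num)
      have h1 : 0 < mhDeg E v := Finset.card_pos.2 ⟨a, by simpa using hv⟩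
      have h2 := hdeg v
      omega
    clear hS
    induction S using Finset.induction_on with
    | empty => exact ⟨fun _ => ⟨0, hk0⟩, fun a ha => by simp at ha⟩
    | insert e S he ih =>
      obtain ⟨c, hc⟩ := ih
      exact hc.exists_insert hcard hdeg hk he
  cases isEmpty_or_nonempty ι with
  | inl h => exact ⟨fun a => isEmptyElim a, fun a => isEmptyElim a⟩
  | inr h =>
    obtain ⟨c, hc⟩ := key Finset.univ Finset.univ_nonempty
    exact ⟨c, fun a b => hc a (Finset.mem_univ a) b (Finset.mem_univ b)⟩

end Shannon

section Construction

/-- A multigraph of maximum degree `Δ` and chromatic index `χ` with a proper edge-coloring into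
classes of size at least `χ` that has no full rainbow matching. -/
structure IsRainbowFree {V ι κ : Type} [Fintype ι] [DecidableEq V] [DecidableEq κ] (Δ χ : ℕ)
    (E : ι → Finset V) (c : ι → κ) : Prop where
  card_eq_two : ∀ a, (E a).card = 2
  deg_le : ∀ v, mhDeg E v ≤ Δ
  exists_deg_eq : ∃ v, mhDeg E v = Δ
  chromaticIndex : isChromaticIndex E χ
  proper : properColoring E c
  le_classSize : ∀ i, χ ≤ classSize c i
  not_rainbow : ¬ hasFullRainbowMatching E c

theorem IsRainbowFree.exists_fin {V ι κ : Type} [Fintype V] [Fintype ι] [Fintype κ]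
    [DecidableEq V] [DecidableEq κ] {Δ χ : ℕ} {E : ι → Finset V} {c : ι → κ}
    (h : IsRainbowFree Δ χ E c) :
    ∃ (N M n : ℕ) (E : Fin M → Finset (Fin N)) (c : Fin M → Fin n), IsRainbowFree Δ χ E c := by
  let eV := Fintype.equivFin V
  let eι := Fintype.equivFin ι
  let eκ := Fintype.equivFin κ
  have hdeg : ∀ v, mhDeg (fun a => (E (eι.symm a)).map eV.toEmbedding) v =
      mhDeg E (eV.symm v) := by
    intro v
    refine Finset.card_equiv eι.symm fun a => ?_
    simp [Finset.mem_map_equiv]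
  refine ⟨_, _, _, fun a => (E (eι.symm a)).map eV.toEmbedding, fun a => eκ (c (eι.symm a)),
    ⟨fun a => ?_, fun v => ?_, ?_, ⟨?_, ?_⟩, ?_, fun i => ?_, ?_⟩⟩
  · rw [Finset.card_map]
    exact h.card_eq_two _
  · rw [hdeg]
    exact h.deg_le _
  · obtain ⟨v, hv⟩ := h.exists_deg_eq
    exact ⟨eV v, by rw [hdeg, eV.symm_apply_apply, hv]⟩
  · obtain ⟨d, hd⟩ := h.chromaticIndex.1
    refine ⟨fun a => d (eι.symm a), fun a b hab hc => ?_⟩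
    rw [Finset.disjoint_map]
    exact hd _ _ (eι.symm.injective.ne hab) hc
  · rintro k ⟨d, hd⟩
    refine h.chromaticIndex.2 ⟨fun a => d (eι a), fun a b hab hc => ?_⟩
    have := hd _ _ (eι.injective.ne hab) hc
    rw [Finset.disjoint_map] at this
    simpa using this
  · intro a b hab hc
    rw [Finset.disjoint_map]
    exact h.proper _ _ (eι.symm.injective.ne hab) (eκ.injective hc)
  · refine (h.le_classSize (eκ.symm i)).trans (Finset.card_equiv eι fun a => ?_).le
    simp [Equiv.eq_symm_apply]
  · rintro ⟨f, hf, hd⟩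
    refine h.not_rainbow ⟨fun i => eι.symm (f (eκ i)), fun i => eκ.injective (hf _),
      fun i j hij => ?_⟩
    have := hd _ _ (eκ.injective.ne hij)
    rwa [Finset.disjoint_map] at this

theorem le_of_mhDeg_eq {V ι : Type} [Fintype ι] [DecidableEq V] {E : ι → Finset V} {k Δ : ℕ}
    {v : V} (hv : mhDeg E v = Δ) {c : ι → Fin k} (hc : properColoring E c) : Δ ≤ k := by
  have := Finset.card_le_card_of_injOn (s := Finset.univ.filter fun a => v ∈ E a)
    (t := (Finset.univ : Finset (Fin k))) c (fun _ _ => Finset.mem_coe.2 (Finset.mem_univ _)) (by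
      intro a ha b hb hab
      by_contra hne
      simp only [Finset.coe_filter, Finset.mem_univ, true_and, Set.mem_ofPred_eq] at ha hb
      exact Finset.disjoint_left.1 (hc a b hne hab) ha hb)
  rw [Finset.card_univ, Fintype.card_fin] at this
  exact hv ▸ this

theorem le_of_pairwise_not_disjoint {V ι : Type} {E : ι → Finset V} {k p : ℕ} {e : Fin p → ι}
    (he : Function.Injective e) (hE : ∀ i j, ¬ Disjoint (E (e i)) (E (e j))) {c : ι → Fin k}
    (hc : properColoring E c) : p ≤ k := by
  have hinj : Function.Injective fun i => c (e i) := fun i j hij => by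
    by_contra hne
    exact hE i j (hc _ _ (he.ne hne) hij)
  simpa using Fintype.card_le_of_injective _ hinj

theorem card_filter_fin_le {p l u : ℕ} (P : Fin p → Prop) [DecidablePred P]
    (h : ∀ j, P j → l ≤ j ∧ (j : ℕ) < u) : (Finset.univ.filter P).card ≤ u - l := by
  rw [← Nat.card_Ico]
  refine Finset.card_le_card_of_injOn Fin.val (fun j hj => ?_) Fin.val_injective.injOn
  simpa using h j (by simpa using hj)

/-- A triangle with `p` edges, in which the vertex `0` has degree `Δ`. -/
def fatTriangle (Δ p : ℕ) (j : Fin p) : Finset (Fin 4) :=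
  if (j : ℕ) < (Δ + 1) / 2 then {0, 1} else if (j : ℕ) < Δ then {0, 2} else {1, 2}

/-- A path `0 - 1 - 2 - 3` with a single middle edge, whose outer edges have multiplicities
`⌈p/2⌉` and `⌊p/2⌋`. -/
def fatPath (p : ℕ) : Option (Fin p) → Finset (Fin 4)
  | none => {1, 2}
  | some j => if (j : ℕ) < (p + 1) / 2 then {0, 1} else {2, 3}

theorem card_fatTriangle (Δ p : ℕ) (j : Fin p) : (fatTriangle Δ p j).card = 2 := by
  unfold fatTriangle
  split_ifs <;> rfl

theorem card_fatPath (p : ℕ) (j : Option (Fin p)) : (fatPath p j).card = 2 := by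
  rcases j with _ | j
  · rfl
  · unfold fatPath
    dsimp only
    split_ifs <;> rfl

theorem not_disjoint_fatTriangle (Δ p : ℕ) (i j : Fin p) :
    ¬ Disjoint (fatTriangle Δ p i) (fatTriangle Δ p j) := by
  unfold fatTriangle
  split_ifs <;> decide

theorem not_disjoint_fatPath_none (p : ℕ) (j : Fin p) :
    ¬ Disjoint (fatPath p none) (fatPath p (some j)) := by
  unfold fatPath
  dsimp only
  split_ifs <;> decide

theorem mhDeg_fatTriangle_zero {Δ p : ℕ} (h : Δ ≤ p) : mhDeg (fatTriangle Δ p) 0 = Δ := by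
  have h1 : ∀ j : Fin p, 0 ∈ fatTriangle Δ p j ↔ (j : ℕ) < Δ := by
    intro j
    unfold fatTriangle
    split_ifs <;> simp <;> omega
  unfold mhDeg
  simp only [h1]
  rw [Fin.card_filter_val_lt]
  omega

theorem mhDeg_fatTriangle_le {Δ p : ℕ} (h : Δ ≤ p) (h' : p ≤ Δ + Δ / 2) (v : Fin 4) :
    mhDeg (fatTriangle Δ p) v ≤ Δ := by
  fin_cases v
  · exact (mhDeg_fatTriangle_zero h).le
  · have h1 : ∀ j : Fin p, 1 ∈ fatTriangle Δ p j ↔ (j : ℕ) < (Δ + 1) / 2 ∨ Δ ≤ (j : ℕ) := by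
      intro j
      unfold fatTriangle
      split_ifs <;> simp <;> omega
    unfold mhDeg
    simp only [Fin.mk_one, h1]
    rw [Finset.filter_or]
    refine (Finset.card_union_le _ _).trans ?_
    have h2 := card_filter_fin_le (p := p) (l := 0) (u := (Δ + 1) / 2)
      (fun j => (j : ℕ) < (Δ + 1) / 2) fun j hj => ⟨Nat.zero_le _, hj⟩
    have h3 := card_filter_fin_le (p := p) (l := Δ) (u := p)
      (fun j => Δ ≤ (j : ℕ)) fun j hj => ⟨hj, j.2⟩
    omega
  · refine (card_filter_fin_le (l := (Δ + 1) / 2) (u := p) _ fun j hj => ⟨?_, j.2⟩).trans (by omega)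
    by_contra hlt
    simp [fatTriangle, not_le.1 hlt] at hj
  · refine (card_filter_fin_le (l := 0) (u := 0) _ fun j hj => ?_).trans (by omega)
    unfold fatTriangle at hj
    split_ifs at hj <;> simp at hj

theorem mhDeg_fatPath_le {Δ p : ℕ} (h : p ≤ 2 * Δ - 2) (hΔ : 2 ≤ Δ) (v : Fin 4) :
    mhDeg (fatPath p) v ≤ Δ := by
  unfold mhDeg
  rw [Finset.card_filter, Fintype.sum_option, ← Finset.card_filter]
  have key : (Finset.univ.filter fun j : Fin p => v ∈ fatPath p (some j)).card ≤ Δ - 1 := by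
    by_cases hv : v = 0 ∨ v = 1
    · refine (card_filter_fin_le (l := 0) (u := (p + 1) / 2) _ fun j hj => ⟨Nat.zero_le _, ?_⟩).trans
        (by omega)
      by_contra hlt
      simp only [fatPath, hlt] at hj
      rcases hv with rfl | rfl <;> simp at hj
    · refine (card_filter_fin_le (l := (p + 1) / 2) (u := p) _ fun j hj => ⟨?_, j.2⟩).trans
        (by omega)
      by_contra hlt
      simp only [fatPath, not_le.1 hlt] at hj
      simp at hj
      exact hv hj
  split_ifs <;> omega

theorem exists_properColoring_fatPath {Δ p : ℕ} (h : p ≤ 2 * Δ - 2) (hΔ : 2 ≤ Δ) (hp : Δ ≤ p) :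
    ∃ c : Option (Fin p) → Fin p, properColoring (fatPath p) c := by
  refine ⟨fun j => j.elim ⟨Δ - 1, by omega⟩ fun j =>
    ⟨if (j : ℕ) < (p + 1) / 2 then j else j - (p + 1) / 2, by split_ifs <;> omega⟩, ?_⟩
  rintro (_ | i) (_ | j) hij hc
  · exact absurd rfl hij
  · simp only [Option.elim, Fin.mk.injEq] at hc
    split_ifs at hc <;> omega
  · simp only [Option.elim, Fin.mk.injEq] at hc
    split_ifs at hc <;> omega
  · simp only [Option.elim, Fin.mk.injEq] at hc
    have hne : (i : ℕ) ≠ j := fun h => hij (by rw [Fin.ext h])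
    unfold fatPath
    dsimp only
    split_ifs at hc ⊢ <;> first | decide | omega

/-- The disjoint union of fat triangles indexed by `T` and fat paths indexed by `P`; the first
coordinate of an edge is the index of its component. -/
def gadgetUnion (T P : Type) (Δ p : ℕ) :
    T × Fin p ⊕ P × Option (Fin p) → Finset ((T ⊕ P) × Fin 4)
  | .inl (t, j) => {.inl t} ×ˢ fatTriangle Δ p j
  | .inr (i, j) => {.inr i} ×ˢ fatPath p j

theorem mhDeg_gadgetUnion_inl {T P : Type} [Fintype T] [Fintype P] [DecidableEq T] [DecidableEq P]
    (Δ p : ℕ) (t : T) (v : Fin 4) :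
    mhDeg (gadgetUnion T P Δ p) (.inl t, v) = mhDeg (fatTriangle Δ p) v := by
  symm
  refine Finset.card_bij (fun j _ => .inl (t, j)) ?_ ?_ ?_
  · intro j hj
    simpa [gadgetUnion] using hj
  · intro i _ j _ hij
    simpa using hij
  · rintro (⟨s, j⟩ | ⟨s, j⟩) hj
    · replace hj := (Finset.mem_filter.1 hj).2
      simp only [gadgetUnion, Finset.mem_product, Finset.mem_singleton, Sum.inl.injEq] at hj
      exact ⟨j, by simpa using hj.2, by rw [hj.1]⟩
    · simp [gadgetUnion] at hj

theorem mhDeg_gadgetUnion_inr {T P : Type} [Fintype T] [Fintype P] [DecidableEq T] [DecidableEq P]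
    (Δ p : ℕ) (i : P) (v : Fin 4) :
    mhDeg (gadgetUnion T P Δ p) (.inr i, v) = mhDeg (fatPath p) v := by
  symm
  refine Finset.card_bij (fun j _ => .inr (i, j)) ?_ ?_ ?_
  · intro j hj
    simpa [gadgetUnion] using hj
  · intro i _ j _ hij
    simpa using hij
  · rintro (⟨s, j⟩ | ⟨s, j⟩) hj
    · simp [gadgetUnion] at hj
    · replace hj := (Finset.mem_filter.1 hj).2
      simp only [gadgetUnion, Finset.mem_product, Finset.mem_singleton, Sum.inr.injEq] at hj
      exact ⟨j, by simpa using hj.2, by rw [hj.1]⟩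

theorem isChromaticIndex_gadgetUnion {T P : Type} [Nonempty T] {Δ p : ℕ} (h : p ≤ 2 * Δ - 2)
    (hΔ : 2 ≤ Δ) (hp : Δ ≤ p) : isChromaticIndex (gadgetUnion T P Δ p) p := by
  constructor
  · obtain ⟨d, hd⟩ := exists_properColoring_fatPath h hΔ hp
    refine ⟨Sum.elim Prod.snd fun a => d a.2, ?_⟩
    rintro (⟨s, i⟩ | ⟨s, i⟩) (⟨t, j⟩ | ⟨t, j⟩) hab hc <;>
      simp only [Sum.elim_inl, Sum.elim_inr] at hc <;>
      simp only [gadgetUnion, Finset.disjoint_product]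
    · subst hc
      left
      simpa using hab
    · left
      simp
    · left
      simp
    · by_cases hst : s = t
      · subst hst
        right
        exact hd _ _ (by simpa using hab) hc
      · left
        simpa using hst
  · rintro k ⟨c, hc⟩
    obtain ⟨t⟩ := ‹Nonempty T›
    refine le_of_pairwise_not_disjoint (e := fun j => .inl (t, j)) (fun i j hij => ?_)
      (fun i j => ?_) hc
    · simpa using hij
    · simp only [gadgetUnion, Finset.disjoint_product, not_or]
      exact ⟨by simp, not_disjoint_fatTriangle Δ p i j⟩

/-- The palettes are indexed by `Option (Fin p)`, each having `p` colors. Every palette colors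
`p - 1` fat triangles; the `i`-th fat path has its outer edges colored by the palette `some i`,
and its middle edge by the `i`-th color of the palette `none`. -/
def gadgetColoring (p : ℕ) :
    (Fin (p - 1) × Option (Fin p)) × Fin p ⊕ Fin p × Option (Fin p) → Option (Fin p) × Fin p
  | .inl ((_, q), j) => (q, j)
  | .inr (i, none) => (none, i)
  | .inr (i, some j) => (some i, j)

theorem isRainbowFree_gadget {Δ p : ℕ} (h : p ≤ 2 * Δ - 2) (hΔ : 2 ≤ Δ) (hp : Δ ≤ p)
    (h' : p ≤ Δ + Δ / 2) :
    IsRainbowFree Δ p (gadgetUnion (Fin (p - 1) × Option (Fin p)) (Fin p) Δ p)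
      (gadgetColoring p) := by
  have : Nonempty (Fin (p - 1) × Option (Fin p)) := ⟨⟨0, by omega⟩, none⟩
  refine ⟨?_, ?_, ?_, isChromaticIndex_gadgetUnion h hΔ hp, ?_, ?_, ?_⟩
  · rintro (⟨t, j⟩ | ⟨t, j⟩)
    · simp [gadgetUnion, card_fatTriangle]
    · simp [gadgetUnion, card_fatPath]
  · rintro ⟨t | i, v⟩
    · rw [mhDeg_gadgetUnion_inl]
      exact mhDeg_fatTriangle_le hp h' v
    · rw [mhDeg_gadgetUnion_inr]
      exact mhDeg_fatPath_le h hΔ v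
  · obtain ⟨t⟩ := this
    exact ⟨(.inl t, 0), by rw [mhDeg_gadgetUnion_inl, mhDeg_fatTriangle_zero hp]⟩
  · rintro (⟨⟨s, q⟩, i⟩ | ⟨s, _ | i⟩) (⟨⟨t, r⟩, j⟩ | ⟨t, _ | j⟩) hab hc <;>
      simp only [gadgetColoring, Prod.mk.injEq, reduceCtorEq, false_and, Option.some.injEq,
        true_and] at hc <;>
      simp only [gadgetUnion, Finset.disjoint_product] <;> left <;> simp <;> grind
  · rintro ⟨q, j⟩
    let e : Option (Fin (p - 1)) →
        (Fin (p - 1) × Option (Fin p)) × Fin p ⊕ Fin p × Option (Fin p) := fun t =>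
      t.elim (.inr (q.elim (j, none) fun i => (i, some j))) fun t => .inl ((t, q), j)
    have he : Function.Injective e := by
      rintro (_ | s) (_ | t) hst <;> simp [e] at hst ⊢
      exact hst
    have h1 := Finset.card_le_card_of_injOn (s := Finset.univ)
      (t := Finset.univ.filter fun a => gadgetColoring p a = (q, j)) e (by
        rintro (_ | t) -
        · rcases q with _ | i <;> exact Finset.mem_filter.2 ⟨Finset.mem_univ _, rfl⟩
        · exact Finset.mem_filter.2 ⟨Finset.mem_univ _, rfl⟩) he.injOn
    rw [Finset.card_univ, Fintype.card_option, Fintype.card_fin] at h1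
    unfold classSize
    omega
  · rintro ⟨f, hf, hd⟩
    have key : ∀ q, ∃ j, ∀ t, f (q, j) ≠ .inl ((t, q), j) := by
      intro q
      by_contra! hcon
      choose t ht using hcon
      obtain ⟨i, j, hij, htt⟩ := Fintype.exists_ne_map_eq_of_card_lt t (by simp; omega)
      have := hd (q, i) (q, j) (by simpa using hij)
      rw [ht, ht, htt] at this
      simp only [gadgetUnion, Finset.disjoint_product] at this
      rcases this with this | this
      · simp at this
      · exact not_disjoint_fatTriangle _ _ _ _ this
    have key' : ∀ q j, (∀ t, f (q, j) ≠ .inl ((t, q), j)) →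
        f (q, j) = .inr (q.elim (j, none) fun i => (i, some j)) := by
      intro q j hne
      have hc := hf (q, j)
      rcases hfa : f (q, j) with ⟨⟨t, r⟩, i⟩ | ⟨i, _ | i'⟩ <;> rw [hfa] at hc <;>
        simp only [gadgetColoring, Prod.mk.injEq] at hc <;> obtain ⟨rfl, rfl⟩ := hc
      · exact absurd hfa (hne t)
      · rfl
      · rfl
    obtain ⟨i, hi⟩ := key none
    obtain ⟨j, hj⟩ := key (some i)
    have := hd (none, i) (some i, j) (by simp)
    rw [key' _ _ hi, key' _ _ hj] at this
    simp only [Option.elim, gadgetUnion, Finset.disjoint_product] at this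
    rcases this with this | this
    · simp at this
    · exact not_disjoint_fatPath_none _ _ this

/-- Three copies of the disjoint union of a triangle on `0, 1, 2` and a four-cycle
on `3, 4, 5, 6`. -/
def trianglesAndSquares (a : Fin 3 × Fin 7) : Finset (Fin 3 × Fin 7) :=
  {a.1} ×ˢ (![{0, 1}, {1, 2}, {2, 0}, {3, 4}, {4, 5}, {5, 6}, {6, 3}] : Fin 7 → Finset (Fin 7)) a.2

/-- The triangles share the color `none`; the other two colors of each triangle alternate on its
four-cycle. -/
def trianglesAndSquaresColoring (a : Fin 3 × Fin 7) : Option (Fin 3 × Fin 2) :=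
  (![none, some 0, some 1, some 0, some 1, some 0, some 1] : Fin 7 → Option (Fin 2)) a.2 |>.map
    fun i => (a.1, i)

set_option maxRecDepth 100000 in
theorem isRainbowFree_trianglesAndSquares :
    IsRainbowFree 2 3 trianglesAndSquares trianglesAndSquaresColoring where
  card_eq_two := by decide
  deg_le := by decide
  exists_deg_eq := ⟨(0, 0), by decide⟩
  chromaticIndex := by
    refine ⟨⟨fun a => ![0, 1, 2, 0, 1, 0, 1] a.2, by unfold properColoring; decide⟩, ?_⟩
    rintro k ⟨c, hc⟩
    exact le_of_pairwise_not_disjoint (e := fun i : Fin 3 => (0, i.castLE (by norm_num)))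
      (by decide) (by decide) hc
  proper := by unfold properColoring; decide
  le_classSize := by decide
  not_rainbow := by
    rintro ⟨f, hf, hd⟩
    have key : ∀ a b : Fin 3 × Fin 7, (a.1, decide (a.2 < 3)) = (b.1, decide (b.2 < 3)) →
        trianglesAndSquaresColoring a ≠ trianglesAndSquaresColoring b →
        ¬ Disjoint (trianglesAndSquares a) (trianglesAndSquares b) := by decide
    obtain ⟨i, j, hij, hfij⟩ := Fintype.exists_ne_map_eq_of_card_lt
      (fun i => ((f i).1, decide ((f i).2 < 3))) (by simp)
    exact key _ _ hfij (by rwa [hf, hf]) (hd i j hij)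

end Construction

/-- For every multigraph `H` with maximum degree `Δ ≥ 2` and chromatic index `χ'`, there is a
multigraph `G` with maximum degree `Δ` and chromatic index `χ'` together with a proper
edge-coloring whose classes all have size at least `χ' - 1` and with no full rainbow matching;
moreover if `H` has at most `2Δ - 1` edges then the classes can all have size at least `χ'`. -/
theorem stmt4 {VH ιH : Type} [Fintype VH] [Fintype ιH] [DecidableEq VH]
    (Δ χ' : ℕ) (hΔ : 2 ≤ Δ)
    (EH : ιH → Finset VH) (hcardH : ∀ a, (EH a).card = 2)
    (hdegH : ∀ v, mhDeg EH v ≤ Δ) (hdegHeq : ∃ v, mhDeg EH v = Δ)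
    (hchromH : isChromaticIndex EH χ') :
    (∃ (N M n : ℕ) (E : Fin M → Finset (Fin N)) (c : Fin M → Fin n),
      (∀ a, (E a).card = 2) ∧
      (∀ v, mhDeg E v ≤ Δ) ∧ (∃ v, mhDeg E v = Δ) ∧
      isChromaticIndex E χ' ∧
      properColoring E c ∧
      (∀ i : Fin n, χ' - 1 ≤ classSize c i) ∧
      ¬ hasFullRainbowMatching E c) ∧
    (Fintype.card ιH ≤ 2 * Δ - 1 →
      ∃ (N M n : ℕ) (E : Fin M → Finset (Fin N)) (c : Fin M → Fin n),
        (∀ a, (E a).card = 2) ∧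
        (∀ v, mhDeg E v ≤ Δ) ∧ (∃ v, mhDeg E v = Δ) ∧
        isChromaticIndex E χ' ∧
        properColoring E c ∧
        (∀ i : Fin n, χ' ≤ classSize c i) ∧
        ¬ hasFullRainbowMatching E c) := by
  obtain ⟨v, hv⟩ := hdegHeq
  obtain ⟨cH, hcH⟩ := hchromH.1
  have hlow : Δ ≤ χ' := le_of_mhDeg_eq hv hcH
  have hup : χ' ≤ Δ + Δ / 2 :=
    hchromH.2 (exists_properColoring_of_mhDeg_le hcardH hdegH le_rfl)
  obtain ⟨N, M, n, E, c, h⟩ : ∃ (N M n : ℕ) (E : Fin M → Finset (Fin N)) (c : Fin M → Fin n),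
      IsRainbowFree Δ χ' E c := by
    by_cases h : χ' ≤ 2 * Δ - 2
    · exact (isRainbowFree_gadget h hΔ hlow hup).exists_fin
    · obtain ⟨rfl, rfl⟩ : Δ = 2 ∧ χ' = 3 := by omega
      exact isRainbowFree_trianglesAndSquares.exists_fin
  exact ⟨⟨N, M, n, E, c, h.card_eq_two, h.deg_le, h.exists_deg_eq, h.chromaticIndex, h.proper,
      fun i => (Nat.sub_le _ _).trans (h.le_classSize i), h.not_rainbow⟩,
    fun _ => ⟨N, M, n, E, c, h.card_eq_two, h.deg_le, h.exists_deg_eq, h.chromaticIndex, h.proper,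
      h.le_classSize, h.not_rainbow⟩⟩
end

section
/- For every integer Δ ≥ 2, there exist a multigraph G with maximum degree Δ and a proper edge-coloring of G into color classes E_1, …, E_n such that |E_i| ≥ ⌊3Δ/2⌋ for every i and G has no full rainbow matching with respect to E_1, …, E_n. -/
open Finset

/-- Finite index types of a properly edge-colored multigraph without full rainbow matching may be
replaced by initial segments of `ℕ`. -/
theorem exists_fin_of_fintype {V ι κ : Type} [Fintype V] [Fintype ι] [Fintype κ]
    [DecidableEq V] [DecidableEq κ] (Δ s : ℕ) (E : ι → Finset V) (c : ι → κ)
    (hcard : ∀ a, (E a).card = 2) (hle : ∀ v, mhDeg E v ≤ Δ) (hex : ∃ v, mhDeg E v = Δ)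
    (hproper : properColoring E c) (hsize : ∀ i, s ≤ classSize c i)
    (hno : ¬ hasFullRainbowMatching E c) :
    ∃ (N M n : ℕ) (E : Fin M → Finset (Fin N)) (c : Fin M → Fin n),
      (∀ a, (E a).card = 2) ∧
      (∀ v, mhDeg E v ≤ Δ) ∧ (∃ v, mhDeg E v = Δ) ∧
      properColoring E c ∧
      (∀ i : Fin n, s ≤ classSize c i) ∧
      ¬ hasFullRainbowMatching E c := by
  let eV := Fintype.equivFin V
  let eι := Fintype.equivFin ι
  let eκ := Fintype.equivFin κ
  let E' : Fin (Fintype.card ι) → Finset (Fin (Fintype.card V)) :=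
    fun a => (E (eι.symm a)).map eV.toEmbedding
  let c' : Fin (Fintype.card ι) → Fin (Fintype.card κ) := fun a => eκ (c (eι.symm a))
  have hdeg : ∀ v, mhDeg E' (eV v) = mhDeg E v := by
    intro v
    refine Finset.card_equiv eι.symm fun a => ?_
    simp [E']
  refine ⟨_, _, _, E', c', ?_, ?_, ?_, ?_, ?_, ?_⟩
  · intro a
    simp [E', hcard]
  · intro v
    obtain ⟨v, rfl⟩ := eV.surjective v
    exact (hdeg v).trans_le (hle v)
  · obtain ⟨v, hv⟩ := hex
    exact ⟨eV v, (hdeg v).trans hv⟩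
  · intro a b hab h
    exact (Finset.disjoint_map _).2
      (hproper _ _ (eι.symm.injective.ne hab) (eκ.injective h))
  · intro i
    obtain ⟨i, rfl⟩ := eκ.surjective i
    refine (hsize i).trans_eq (Eq.symm ?_)
    refine Finset.card_equiv eι.symm fun a => ?_
    simp [c']
  · rintro ⟨f, hf, hd⟩
    refine hno ⟨fun i => eι.symm (f (eκ i)), fun i => eκ.injective (hf (eκ i)), fun i j hij => ?_⟩
    exact (Finset.disjoint_map _).1 (hd _ _ (eκ.injective.ne hij))

/-- If the edges are split into fewer parts than there are colors, and differently colored edges of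
the same part always meet, then there is no full rainbow matching. -/
theorem not_hasFullRainbowMatching_of_card_lt {V ι κ π : Type} [Fintype κ] [Fintype π]
    (E : ι → Finset V) (c : ι → κ) (p : ι → π) (hlt : Fintype.card π < Fintype.card κ)
    (hmeet : ∀ a b, c a ≠ c b → p a = p b → ¬ Disjoint (E a) (E b)) :
    ¬ hasFullRainbowMatching E c := by
  rintro ⟨f, hf, hd⟩
  obtain ⟨i, j, hij, h⟩ := Fintype.exists_ne_map_eq_of_card_lt (fun i => p (f i)) hlt
  exact hmeet (f i) (f j) (by rwa [hf, hf]) h (hd i j hij)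

/-- Vertices of the graph of maximum degree two: three 4-cycles and two triangles. -/
abbrev CycleVertex : Type := Fin 3 × Fin 4 ⊕ Fin 2 × Fin 3

/-- Two vertex-disjoint edges of color `(i, k)` lie in the 4-cycle `i`, and one in the
triangle `k`. -/
def cycleEdge : (Fin 3 × Fin 2) × Fin 3 → Finset CycleVertex
  | ((i, k), 0) => {.inl (i, 0), .inl (i, if k = 0 then 1 else 3)}
  | ((i, k), 1) => {.inl (i, 2), .inl (i, if k = 0 then 3 else 1)}
  | ((i, k), 2) => {.inr (k, i), .inr (k, i + 1)}

/-- The cycle containing an edge. -/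
def cycleOf : (Fin 3 × Fin 2) × Fin 3 → Fin 3 ⊕ Fin 2
  | ((_, k), 2) => .inr k
  | ((i, _), _) => .inl i

/-- The case of maximum degree two. -/
theorem exists_no_rainbow_matching_of_two :
    ∃ (N M n : ℕ) (E : Fin M → Finset (Fin N)) (c : Fin M → Fin n),
      (∀ a, (E a).card = 2) ∧
      (∀ v, mhDeg E v ≤ 2) ∧ (∃ v, mhDeg E v = 2) ∧
      properColoring E c ∧
      (∀ i : Fin n, 3 ≤ classSize c i) ∧
      ¬ hasFullRainbowMatching E c := by
  refine exists_fin_of_fintype 2 3 cycleEdge Prod.fst ?_ ?_ ⟨.inl (0, 0), ?_⟩ ?_ ?_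
    (not_hasFullRainbowMatching_of_card_lt _ _ cycleOf ?_ ?_)
  · decide
  · unfold mhDeg
    decide +kernel
  · unfold mhDeg
    decide +kernel
  · unfold properColoring
    decide +kernel
  · unfold classSize
    decide +kernel
  · decide
  · decide +kernel

/-- Vertices of the general construction: a triangle for every group `g : Option (Fin (m + 1))` of
colors and every `t : Fin m`, and a path on four vertices for every `i : Fin (m + 1)`. -/
abbrev FatVertex (m : ℕ) : Type := (Option (Fin (m + 1)) × Fin m) × Fin 3 ⊕ Fin (m + 1) × Fin 4

/-- Colors of the general construction: `m + 2` groups of `m + 1` colors each. -/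
abbrev FatColor (m : ℕ) : Type := Option (Fin (m + 1)) × Fin (m + 1)

/-- Side of a fat triangle in which the color of index `j` is placed. -/
def fatSide (b j : ℕ) : Finset (Fin 3) :=
  if j < b then {0, 1} else if j < 2 * b then {1, 2} else {0, 2}

/-- Edges of the general construction. Every color of the group `g` has one edge in each of the
triangles `(g, t)`; its remaining edge is an outer edge of the path `i` if `g = some i`, and the
middle edge of the path `j` if it is the color `j` of the group `none`. -/
def fatEdge (m b l : ℕ) : FatColor m × Option (Fin m) → Finset (FatVertex m)
  | ((g, j), some t) => (fatSide b j).map ⟨fun x => .inl ((g, t), x), fun x y h => by simpa using h⟩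
  | ((some i, j), none) =>
    if (j : ℕ) < l then {.inr (i, 0), .inr (i, 1)} else {.inr (i, 2), .inr (i, 3)}
  | ((none, j), none) => {.inr (j, 1), .inr (j, 2)}

theorem card_fatSide (b j : ℕ) : (fatSide b j).card = 2 := by
  unfold fatSide
  split_ifs <;> rfl

theorem not_disjoint_fatSide (b j k : ℕ) : ¬ Disjoint (fatSide b j) (fatSide b k) := by
  unfold fatSide
  split_ifs <;> decide

theorem card_fatEdge (m b l : ℕ) (a : FatColor m × Option (Fin m)) :
    (fatEdge m b l a).card = 2 := by
  obtain ⟨⟨_ | i, j⟩, _ | t⟩ := a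
  · simp [fatEdge]
  · simp [fatEdge, card_fatSide]
  · simp only [fatEdge]
    split_ifs <;> simp
  · simp [fatEdge, card_fatSide]

theorem inl_mem_fatEdge {m b l : ℕ} {g h : Option (Fin (m + 1))} {t : Fin m} {x : Fin 3}
    {j : Fin (m + 1)} {s : Option (Fin m)} :
    (.inl ((g, t), x) : FatVertex m) ∈ fatEdge m b l ((h, j), s) ↔
      h = g ∧ s = some t ∧ x ∈ fatSide b j := by
  rcases s with _ | s
  · rcases h with _ | i
    · simp [fatEdge]
    · simp only [fatEdge]
      split_ifs <;> simp
  · simp only [fatEdge, Finset.mem_map, Option.some.injEq]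
    constructor
    · rintro ⟨y, hy, hyx⟩
      cases hyx
      exact ⟨rfl, rfl, hy⟩
    · rintro ⟨rfl, rfl, hx⟩
      exact ⟨x, hx, rfl⟩

theorem inr_mem_fatEdge {m b l : ℕ} {h : Option (Fin (m + 1))} {i : Fin (m + 1)} {x : Fin 4}
    {j : Fin (m + 1)} {s : Option (Fin m)} :
    (.inr (i, x) : FatVertex m) ∈ fatEdge m b l ((h, j), s) ↔
      s = none ∧ (h = some i ∧ (x < 2 ↔ (j : ℕ) < l) ∨ h = none ∧ j = i ∧ (x = 1 ∨ x = 2)) := by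
  rcases h with _ | k <;> rcases s with _ | s
  · simp [fatEdge]
    tauto
  · simp [fatEdge]
  · simp only [fatEdge]
    split_ifs with hj <;> fin_cases x <;> simp [hj, eq_comm]
  · simp [fatEdge]

theorem properColoring_fatEdge (m b l : ℕ) : properColoring (fatEdge m b l) Prod.fst := by
  rintro ⟨⟨g, j⟩, s⟩ ⟨⟨h, k⟩, s'⟩ hne heq
  rw [Finset.disjoint_left]
  rintro (⟨⟨u, t⟩, x⟩ | ⟨i, x⟩) h1 h2
  · rw [inl_mem_fatEdge] at h1 h2
    simp_all
  · rw [inr_mem_fatEdge] at h1 h2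
    simp_all

theorem classSize_fst (m : ℕ) (i : FatColor m) :
    classSize (Prod.fst : FatColor m × Option (Fin m) → FatColor m) i = m + 1 := by
  have h : (Finset.univ.filter fun a : FatColor m × Option (Fin m) => a.1 = i) =
      {i} ×ˢ Finset.univ := by
    ext a
    simp only [Finset.mem_filter, Finset.mem_product, Finset.mem_singleton, Finset.mem_univ,
      true_and, and_true]
  rw [classSize, h]
  simp

theorem not_hasFullRainbowMatching_fatEdge (m b l : ℕ) :
    ¬ hasFullRainbowMatching (fatEdge m b l) Prod.fst := by
  rintro ⟨f, hf, hd⟩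
  have hgroup : ∀ g, ∃ j, (f (g, j)).2 = none := by
    intro g
    by_contra! h
    choose s hs using fun j => Option.ne_none_iff_exists'.1 (h j)
    obtain ⟨j, k, hjk, hst⟩ := Fintype.exists_ne_map_eq_of_card_lt s (by simp)
    have hj : f (g, j) = ((g, j), some (s k)) := Prod.ext (hf _) ((hs j).trans (by rw [hst]))
    have hk : f (g, k) = ((g, k), some (s k)) := Prod.ext (hf _) (hs k)
    have := hd (g, j) (g, k) (by simpa using hjk)
    rw [hj, hk] at this
    exact not_disjoint_fatSide b j k ((Finset.disjoint_map _).1 this)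
  obtain ⟨i, hi⟩ := hgroup none
  obtain ⟨j, hj⟩ := hgroup (some i)
  have hi' : f (none, i) = ((none, i), none) := Prod.ext (hf _) hi
  have hj' : f (some i, j) = ((some i, j), none) := Prod.ext (hf _) hj
  have := hd (none, i) (some i, j) (by simp)
  rw [hi', hj', Finset.disjoint_left] at this
  by_cases hl : (j : ℕ) < l
  · exact this (a := .inr (i, 1)) (by simp [fatEdge]) (by simp [fatEdge, hl])
  · exact this (a := .inr (i, 2)) (by simp [fatEdge]) (by simp [fatEdge, hl])

theorem mhDeg_fatEdge_inl (m b l : ℕ) (g : Option (Fin (m + 1))) (t : Fin m) (x : Fin 3) :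
    mhDeg (fatEdge m b l) (.inl ((g, t), x)) =
      ((Finset.range (m + 1)).filter fun j => x ∈ fatSide b j).card := by
  refine Finset.card_bij (fun a _ => (a.1.2 : ℕ)) ?_ ?_ ?_
  · rintro ⟨⟨h, j⟩, s⟩ ha
    simp only [Finset.mem_filter, Finset.mem_univ, true_and, inl_mem_fatEdge] at ha
    exact Finset.mem_filter.2 ⟨Finset.mem_range.2 j.isLt, ha.2.2⟩
  · rintro ⟨⟨h, j⟩, s⟩ ha ⟨⟨h', j'⟩, s'⟩ ha' hjj
    simp only [Finset.mem_filter, Finset.mem_univ, true_and, inl_mem_fatEdge] at ha ha'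
    simp_all [Fin.ext_iff]
  · intro j hj
    rw [Finset.mem_filter, Finset.mem_range] at hj
    exact ⟨((g, ⟨j, hj.1⟩), some t), by simp [inl_mem_fatEdge, hj.2], rfl⟩

theorem card_filter_mem_fatSide_le {m b d : ℕ} (hb : 2 * b ≤ d) (hd : m + 1 = d + b)
    (x : Fin 3) : ((Finset.range (m + 1)).filter fun j => x ∈ fatSide b j).card ≤ d := by
  have hcompl : ∃ k, k + b ≤ m + 1 ∧
      ((Finset.range (m + 1)).filter fun j => x ∈ fatSide b j) ⊆
        Finset.range (m + 1) \ Finset.Ico k (k + b) := by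
    fin_cases x
    · refine ⟨b, by omega, fun j => ?_⟩
      simp only [Finset.mem_filter, Finset.mem_range, Finset.mem_sdiff, Finset.mem_Ico]
      unfold fatSide
      split_ifs <;> simp <;> omega
    · refine ⟨2 * b, by omega, fun j => ?_⟩
      simp only [Finset.mem_filter, Finset.mem_range, Finset.mem_sdiff, Finset.mem_Ico]
      unfold fatSide
      split_ifs <;> simp <;> omega
    · refine ⟨0, by omega, fun j => ?_⟩
      simp only [Finset.mem_filter, Finset.mem_range, Finset.mem_sdiff, Finset.mem_Ico]
      unfold fatSide
      split_ifs <;> simp <;> omega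
  obtain ⟨k, hk, hsub⟩ := hcompl
  refine (Finset.card_le_card hsub).trans ?_
  rw [Finset.card_sdiff_of_subset (by intro j; simp; omega)]
  simp
  omega

theorem card_filter_two_mem_fatSide {m b d : ℕ} (hd : m + 1 = d + b) :
    ((Finset.range (m + 1)).filter fun j => (2 : Fin 3) ∈ fatSide b j).card = d := by
  have h : ((Finset.range (m + 1)).filter fun j => (2 : Fin 3) ∈ fatSide b j) =
      Finset.Ico b (m + 1) := by
    ext j
    simp only [Finset.mem_filter, Finset.mem_range, Finset.mem_Ico]
    unfold fatSide
    split_ifs <;> simp <;> omega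
  rw [h, Nat.card_Ico]
  omega

theorem mhDeg_fatEdge_inr_le {m b l d : ℕ} (hl : l + 1 ≤ d) (hm : m + 2 ≤ d + l)
    (i : Fin (m + 1)) (x : Fin 4) : mhDeg (fatEdge m b l) (.inr (i, x)) ≤ d := by
  let S : Finset ℕ := if x < 2 then Finset.range l else Finset.Ico l (m + 1)
  have hS : (insert (m + 1) S).card ≤ d := by
    refine (Finset.card_insert_le _ _).trans ?_
    simp only [S]
    split_ifs <;> simp <;> omega
  refine (Finset.card_le_card_of_injOn
    (fun a => if a.1.1 = none then m + 1 else (a.1.2 : ℕ)) ?_ ?_).trans hS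
  · rintro ⟨⟨h, j⟩, s⟩ ha
    simp only [Finset.coe_filter, Finset.mem_univ, true_and, Set.mem_ofPred_eq,
      inr_mem_fatEdge] at ha
    obtain ⟨-, ⟨rfl, hx⟩ | ⟨rfl, -⟩⟩ := ha
    · by_cases hj : (j : ℕ) < l
      · simp [S, hx.2 hj, hj]
      · simp only [S, if_neg (mt hx.1 hj)]
        simp
        omega
    · simp
  · rintro ⟨⟨h, j⟩, s⟩ ha ⟨⟨h', j'⟩, s'⟩ ha' hjj
    simp only [Finset.coe_filter, Finset.mem_univ, true_and, Set.mem_ofPred_eq,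
      inr_mem_fatEdge] at ha ha'
    have := j.isLt
    have := j'.isLt
    obtain ⟨rfl, ⟨rfl, -⟩ | ⟨rfl, rfl, -⟩⟩ := ha <;>
      obtain ⟨rfl, ⟨rfl, -⟩ | ⟨rfl, rfl, -⟩⟩ := ha' <;> simp_all [Fin.ext_iff]
    omega

/-- For every `Δ ≥ 2` there is a properly edge-colored multigraph with maximum degree `Δ`,
all color classes of size at least `⌊3Δ/2⌋`, and no full rainbow matching. -/
theorem stmt5 (Δ : ℕ) (hΔ : 2 ≤ Δ) :
    ∃ (N M n : ℕ) (E : Fin M → Finset (Fin N)) (c : Fin M → Fin n),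
      (∀ a, (E a).card = 2) ∧
      (∀ v, mhDeg E v ≤ Δ) ∧ (∃ v, mhDeg E v = Δ) ∧
      properColoring E c ∧
      (∀ i : Fin n, 3 * Δ / 2 ≤ classSize c i) ∧
      ¬ hasFullRainbowMatching E c := by
  obtain rfl | hΔ := hΔ.eq_or_lt
  · exact exists_no_rainbow_matching_of_two
  obtain ⟨m, hm⟩ : ∃ m, 3 * Δ / 2 = m + 1 := ⟨3 * Δ / 2 - 1, by omega⟩
  have hd : m + 1 = Δ + Δ / 2 := by omega
  rw [hm]
  refine exists_fin_of_fintype Δ (m + 1) (fatEdge m (Δ / 2) (Δ - 1)) Prod.fst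
    (card_fatEdge _ _ _) ?_ ⟨.inl ((none, ⟨0, by omega⟩), 2), ?_⟩
    (properColoring_fatEdge _ _ _) (fun i => (classSize_fst m i).ge)
    (not_hasFullRainbowMatching_fatEdge _ _ _)
  · rintro (⟨⟨g, t⟩, x⟩ | ⟨i, x⟩)
    · rw [mhDeg_fatEdge_inl]
      exact card_filter_mem_fatSide_le (by omega) hd x
    · exact mhDeg_fatEdge_inr_le (by omega) (by omega) i x
  · rw [mhDeg_fatEdge_inl]
    exact card_filter_two_mem_fatSide hd
end

section
/- For every integer Δ ≥ 2, there exist a bipartite simple graph G with maximum degree Δ and a proper edge-coloring of G into color classes E_1, …, E_n such that |E_i| ≥ Δ + 1 for every i and G has no full rainbow matching with respect to E_1, …, E_n. -/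
open Finset

/-- A bipartite edge family, given by its left and right endpoint maps on arbitrary finite types,
can be relabelled by initial segments of the natural numbers. -/
theorem exists_fin_of_bipartite {A B ι κ : Type} [Fintype A] [Fintype B] [Fintype ι] [Fintype κ]
    [DecidableEq A] [DecidableEq B] [DecidableEq κ] (Δ : ℕ)
    (l : ι → A) (r : ι → B) (c : ι → κ)
    (hinj : ∀ a b, l a = l b → r a = r b → a = b)
    (hl : ∀ v, #{a | l a = v} ≤ Δ) (hr : ∀ v, #{a | r a = v} ≤ Δ)
    (hmax : ∃ v, #{a | l a = v} = Δ)
    (hproper : ∀ a b, c a = c b → (l a = l b ∨ r a = r b) → a = b)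
    (hsize : ∀ i, Δ + 1 ≤ #{a | c a = i})
    (hno : ∀ f : κ → ι, (∀ i, c (f i) = i) → (l ∘ f).Injective → ¬ (r ∘ f).Injective) :
    ∃ (N M n : ℕ) (E : Fin M → Finset (Fin N)) (c : Fin M → Fin n),
      (∀ a, (E a).card = 2) ∧
      (∀ a b, a ≠ b → E a ≠ E b) ∧
      (∃ P : Fin N → Bool, ∀ a, ∀ u ∈ E a, ∀ v ∈ E a, u ≠ v → P u ≠ P v) ∧
      (∀ v, mhDeg E v ≤ Δ) ∧ (∃ v, mhDeg E v = Δ) ∧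
      properColoring E c ∧
      (∀ i : Fin n, Δ + 1 ≤ classSize c i) ∧
      ¬ hasFullRainbowMatching E c := by
  let eV : A ⊕ B ≃ Fin (Fintype.card (A ⊕ B)) := Fintype.equivFin _
  let eι : ι ≃ Fin (Fintype.card ι) := Fintype.equivFin _
  let eκ : κ ≃ Fin (Fintype.card κ) := Fintype.equivFin _
  let E : Fin (Fintype.card ι) → Finset (Fin (Fintype.card (A ⊕ B))) := fun a =>
    {eV (.inl (l (eι.symm a))), eV (.inr (r (eι.symm a)))}
  have hmeml (a) (x : A) : eV (.inl x) ∈ E a ↔ l (eι.symm a) = x := by simp [E, eq_comm]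
  have hmemr (a) (x : B) : eV (.inr x) ∈ E a ↔ r (eι.symm a) = x := by simp [E, eq_comm]
  have hdisj (a b) : Disjoint (E a) (E b) ↔
      l (eι.symm a) ≠ l (eι.symm b) ∧ r (eι.symm a) ≠ r (eι.symm b) := by
    simp [E, eq_comm]
  have hdegl (x : A) : mhDeg E (eV (.inl x)) = #{a | l a = x} := by
    simp only [mhDeg, hmeml]
    exact Finset.card_equiv eι.symm (by simp)
  have hdegr (x : B) : mhDeg E (eV (.inr x)) = #{a | r a = x} := by
    simp only [mhDeg, hmemr]
    exact Finset.card_equiv eι.symm (by simp)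
  refine ⟨_, _, _, E, fun a => eκ (c (eι.symm a)), ?_, ?_, ?_, ?_, ?_, ?_, ?_, ?_⟩
  · intro a
    exact Finset.card_pair (by simp)
  · intro a b hab h
    refine hab (eι.symm.injective (hinj _ _ ?_ ?_))
    · rw [← hmeml, h, hmeml]
    · rw [← hmemr, h, hmemr]
  · refine ⟨fun v => (eV.symm v).isLeft, fun a u hu v hv huv => ?_⟩
    simp only [E, Finset.mem_insert, Finset.mem_singleton] at hu hv
    rcases hu with rfl | rfl <;> rcases hv with rfl | rfl <;> simp_all
  · intro v
    obtain ⟨x | x, rfl⟩ := eV.surjective v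
    · exact (hdegl x).trans_le (hl x)
    · exact (hdegr x).trans_le (hr x)
  · obtain ⟨x, hx⟩ := hmax
    exact ⟨_, (hdegl x).trans hx⟩
  · intro a b hab h
    have hne : eι.symm a ≠ eι.symm b := fun h => hab (eι.symm.injective h)
    have hc := eκ.injective h
    exact (hdisj a b).2 ⟨fun h => hne (hproper _ _ hc (.inl h)),
      fun h => hne (hproper _ _ hc (.inr h))⟩
  · intro i
    refine (hsize (eκ.symm i)).trans_eq ?_
    exact Finset.card_equiv eι (by simp [Equiv.eq_symm_apply])
  · rintro ⟨f, hf, hfd⟩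
    refine hno (fun i => eι.symm (f (eκ i))) (fun i => eκ.injective (hf _)) ?_ ?_
    · intro i j hij
      by_contra hne
      exact ((hdisj _ _).1 (hfd _ _ (eκ.injective.ne hne))).1 hij
    · intro i j hij
      by_contra hne
      exact ((hdisj _ _).1 (hfd _ _ (eκ.injective.ne hne))).2 hij

/-- The addition table of a finite abelian group whose elements do not sum to zero has no
transversal. -/
theorem not_injective_of_add_eq {Z : Type} [Fintype Z] [AddCommGroup Z]
    (hZ : ∑ z : Z, z ≠ 0) (x y : Z → Z) (hxy : ∀ z, x z + y z = z)
    (hx : x.Injective) : ¬ y.Injective := by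
  intro hy
  have h1 : ∑ z, x z = ∑ z, z := (Finite.injective_iff_bijective.1 hx).sum_comp (fun z => z)
  have h2 : ∑ z, y z = ∑ z, z := (Finite.injective_iff_bijective.1 hy).sum_comp (fun z => z)
  have h3 : ∑ z, x z + ∑ z, y z = ∑ z, z := by
    rw [← Finset.sum_add_distrib]
    exact Finset.sum_congr rfl fun z _ => hxy z
  rw [h1, h2] at h3
  exact hZ (by simpa using h3)

theorem sum_zmod_ne_zero (k : ℕ) : ∑ z : ZMod (2 * k + 1 + 1), z ≠ 0 := by
  have h : ∑ z : ZMod (2 * k + 1 + 1), z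
      = ((∑ i ∈ Finset.range (2 * k + 1 + 1), i : ℕ) : ZMod (2 * k + 1 + 1)) := by
    rw [Nat.cast_sum, ← Fin.sum_univ_eq_sum_range
      (fun i => (i : ZMod (2 * k + 1 + 1))) (2 * k + 1 + 1)]
    exact Finset.sum_congr rfl fun z _ => (ZMod.natCast_zmod_val z).symm
  rw [h, Ne, ZMod.natCast_eq_zero_iff]
  have h2 := Finset.sum_range_id_mul_two (2 * k + 1 + 1)
  rintro ⟨q, hq⟩
  rw [hq] at h2
  have h3 : (2 * k + 1 + 1) * (q * 2) = (2 * k + 1 + 1) * (2 * k + 1) := by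
    rw [← mul_assoc, h2]; rfl
  have h4 := Nat.eq_of_mul_eq_mul_left (by omega) h3
  omega

/-- The edges of one gadget: the cells of the addition table of `Z`, the pendant edges at the left
hub, the pendant edges at the right hub, and the edge joining the two hubs. -/
abbrev GadgetEdge (Z : Type) (d : ℕ) : Type := (Z × Z) ⊕ (Fin d ⊕ (Fin d ⊕ Unit))

/-- The vertices on one side of a gadget: rows (or columns) of the table, leaves, and the hub. -/
abbrev GadgetSide (Z : Type) (d : ℕ) : Type := Z ⊕ (Fin d ⊕ Unit)

/-- The left endpoint of an edge of a gadget. -/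
def gadgetLeft {Z : Type} {d : ℕ} : GadgetEdge Z d → GadgetSide Z d
  | .inl (x, _) => .inl x
  | .inr (.inl _) => .inr (.inr ())
  | .inr (.inr (.inl t)) => .inr (.inl t)
  | .inr (.inr (.inr _)) => .inr (.inr ())

/-- The right endpoint of an edge of a gadget. -/
def gadgetRight {Z : Type} {d : ℕ} : GadgetEdge Z d → GadgetSide Z d
  | .inl (_, y) => .inl y
  | .inr (.inl s) => .inr (.inl s)
  | .inr (.inr (.inl _)) => .inr (.inr ())
  | .inr (.inr (.inr _)) => .inr (.inr ())

/-- The color of an edge within a gadget; `none` is the color shared by all gadgets. -/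
def gadgetColor {Z : Type} [Add Z] {d : ℕ} (σ τ : Fin d → Z) : GadgetEdge Z d → Option Z
  | .inl (x, y) => some (x + y)
  | .inr (.inl s) => some (σ s)
  | .inr (.inr (.inl t)) => some (τ t)
  | .inr (.inr (.inr _)) => none

/-- Any full rainbow choice of private colors in a gadget blocks the edge joining the hubs. -/
theorem gadget_blocks {Z : Type} [Fintype Z] [AddCommGroup Z] (hZ : ∑ z : Z, z ≠ 0) {d : ℕ}
    (σ τ : Fin d → Z) (g : Z → GadgetEdge Z d) (hg : ∀ z, gadgetColor σ τ (g z) = some z)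
    (hl : (gadgetLeft ∘ g).Injective) (hr : (gadgetRight ∘ g).Injective) :
    ∃ z, gadgetLeft (g z) = .inr (.inr ()) ∨ gadgetRight (g z) = .inr (.inr ()) := by
  by_contra! hcon
  have hcell : ∀ z, ∃ p : Z × Z, g z = .inl p := by
    intro z
    have h1 := hcon z
    have h2 := hg z
    rcases hgz : g z with p | s | t | u
    · exact ⟨p, rfl⟩
    all_goals simp [hgz, gadgetLeft, gadgetRight] at h1
  choose p hp using hcell
  refine not_injective_of_add_eq hZ (fun z => (p z).1) (fun z => (p z).2) (fun z => ?_) ?_ ?_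
  · simpa [hp, gadgetColor] using hg z
  · intro a b hab
    exact hl (by simpa [hp, gadgetLeft] using hab)
  · intro a b hab
    exact hr (by simpa [hp, gadgetRight] using hab)

theorem gadgetEdge_ext {Z : Type} {d : ℕ} {a b : GadgetEdge Z d}
    (hl : gadgetLeft a = gadgetLeft b) (hr : gadgetRight a = gadgetRight b) : a = b := by
  rcases a with ⟨x, y⟩ | s | t | u <;> rcases b with ⟨x', y'⟩ | s' | t' | u' <;>
    simp_all [gadgetLeft, gadgetRight]

theorem gadgetColor_proper {Z : Type} [AddCommGroup Z] {d : ℕ} {σ τ : Fin d → Z}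
    (hσ : σ.Injective) (hτ : τ.Injective) {a b : GadgetEdge Z d}
    (hc : gadgetColor σ τ a = gadgetColor σ τ b)
    (h : gadgetLeft a = gadgetLeft b ∨ gadgetRight a = gadgetRight b) : a = b := by
  rcases a with ⟨x, y⟩ | s | t | u <;> rcases b with ⟨x', y'⟩ | s' | t' | u' <;>
    simp only [gadgetColor, gadgetLeft, gadgetRight, Option.some.injEq, Sum.inl.injEq,
      Sum.inr.injEq, reduceCtorEq, or_self, Prod.mk.injEq] at hc h ⊢
  · rcases h with rfl | rfl <;> simp_all
  · exact hσ hc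
  · exact hτ hc

theorem card_gadgetLeft {Z : Type} [Fintype Z] [DecidableEq Z] {d : ℕ} (v : GadgetSide Z d) :
    #{a | gadgetLeft a = v} =
      Sum.elim (fun _ => Fintype.card Z) (Sum.elim (fun _ => 1) (fun _ => d + 1)) v := by
  rw [Finset.card_filter, Fintype.sum_sum_type, Fintype.sum_prod_type]
  rcases v with x | t | u <;> simp [gadgetLeft]

theorem card_gadgetRight {Z : Type} [Fintype Z] [DecidableEq Z] {d : ℕ} (v : GadgetSide Z d) :
    #{a | gadgetRight a = v} =
      Sum.elim (fun _ => Fintype.card Z) (Sum.elim (fun _ => 1) (fun _ => d + 1)) v := by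
  rw [Finset.card_filter, Fintype.sum_sum_type, Fintype.sum_prod_type]
  rcases v with x | t | u <;> simp [gadgetRight]

theorem card_gadgetColor_some {Z : Type} [Fintype Z] [DecidableEq Z] [AddCommGroup Z] {d : ℕ}
    (σ τ : Fin d → Z) (z : Z) :
    #{a | gadgetColor σ τ a = some z} = Fintype.card Z + (#{s | σ s = z} + #{t | τ t = z}) := by
  rw [Finset.card_filter, Fintype.sum_sum_type, Fintype.sum_prod_type]
  simp [gadgetColor, ← eq_sub_iff_add_eq']

/-- The elements of the `k`-th copy of `J` satisfying `p` are as many as those of `J`. -/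
theorem card_filter_fst_eq_and {K J : Type} [Fintype K] [Fintype J] [DecidableEq K]
    (p : J → Prop) [DecidablePred p] (k : K) :
    #{a : K × J | a.1 = k ∧ p a.2} = #{j | p j} := by
  have : (Finset.univ.filter fun a : K × J => a.1 = k ∧ p a.2)
      = {k} ×ˢ (Finset.univ.filter fun j => p j) := by
    ext ⟨a, b⟩; simp [and_comm, eq_comm]
  rw [this, Finset.card_product, Finset.card_singleton, one_mul]

/-- Two injections of `Fin d` into a set of size `d` or `d + 1` that together hit every element
often enough. -/
theorem exists_pendant_colors {Z : Type} [Fintype Z] [DecidableEq Z] {d : ℕ} (hd : 1 ≤ d)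
    (hZ : Fintype.card Z = d ∨ Fintype.card Z = d + 1) :
    ∃ σ τ : Fin d → Z, σ.Injective ∧ τ.Injective ∧
      ∀ z, d + 2 ≤ Fintype.card Z + (#{s | σ s = z} + #{t | τ t = z}) := by
  rcases hZ with h | h
  · let e : Fin d ≃ Z := (Fintype.equivFinOfCardEq h).symm
    refine ⟨e, e, e.injective, e.injective, fun z => ?_⟩
    have : 0 < #{s | e s = z} := Finset.card_pos.2 ⟨e.symm z, by simp⟩
    omega
  · let e : Fin (d + 1) ≃ Z := (Fintype.equivFinOfCardEq h).symm
    refine ⟨fun s => e s.castSucc, fun s => e s.succ,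
      e.injective.comp (Fin.castSucc_injective d), e.injective.comp (Fin.succ_injective d),
      fun z => ?_⟩
    obtain ⟨j, rfl⟩ := e.surjective z
    have : 0 < #{s : Fin d | e s.castSucc = e j} ∨ 0 < #{s : Fin d | e s.succ = e j} := by
      rcases Fin.eq_zero_or_eq_succ j with rfl | ⟨i, rfl⟩
      · exact .inl (Finset.card_pos.2 ⟨⟨0, hd⟩, by simp [Fin.ext_iff]⟩)
      · exact .inr (Finset.card_pos.2 ⟨i, by simp⟩)
    dsimp only
    omega

/-- For every `Δ ≥ 2` there is a properly edge-colored bipartite simple graph with maximum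
degree `Δ`, all color classes of size at least `Δ + 1`, and no full rainbow matching. -/
theorem stmt6 (Δ : ℕ) (hΔ : 2 ≤ Δ) :
    ∃ (N M n : ℕ) (E : Fin M → Finset (Fin N)) (c : Fin M → Fin n),
      (∀ a, (E a).card = 2) ∧
      (∀ a b, a ≠ b → E a ≠ E b) ∧
      (∃ P : Fin N → Bool, ∀ a, ∀ u ∈ E a, ∀ v ∈ E a, u ≠ v → P u ≠ P v) ∧
      (∀ v, mhDeg E v ≤ Δ) ∧ (∃ v, mhDeg E v = Δ) ∧
      properColoring E c ∧
      (∀ i : Fin n, Δ + 1 ≤ classSize c i) ∧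
      ¬ hasFullRainbowMatching E c := by
  obtain ⟨d, rfl⟩ : ∃ d, Δ = d + 1 := ⟨Δ - 1, by omega⟩
  obtain ⟨k, hk⟩ : ∃ k : ℕ, 2 * k + 1 + 1 = d ∨ 2 * k + 1 + 1 = d + 1 :=
    ⟨(d + 1) / 2 - 1, by omega⟩
  let Z := ZMod (2 * k + 1 + 1)
  have hcard : Fintype.card Z = d ∨ Fintype.card Z = d + 1 := by
    rwa [ZMod.card]
  obtain ⟨σ, τ, hσ, hτ, hcol⟩ := exists_pendant_colors (by omega) hcard
  have hdeg (v : GadgetSide Z d) :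
      Sum.elim (fun _ => Fintype.card Z) (Sum.elim (fun _ => 1) (fun _ => d + 1)) v ≤ d + 1 := by
    rcases v with x | t | u <;> simp only [Sum.elim_inl, Sum.elim_inr] <;> omega
  refine exists_fin_of_bipartite (ι := Fin (d + 2) × GadgetEdge Z d) (d + 1)
    (fun a => (a.1, gadgetLeft a.2)) (fun a => (a.1, gadgetRight a.2))
    (fun a => (gadgetColor σ τ a.2).map (Prod.mk a.1)) ?_ ?_ ?_ ?_ ?_ ?_ ?_
  · rintro ⟨i, a⟩ ⟨j, b⟩ hl hr
    simp only [Prod.mk.injEq] at hl hr ⊢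
    exact ⟨hl.1, gadgetEdge_ext hl.2 hr.2⟩
  · rintro ⟨i, v⟩
    simp only [Prod.mk.injEq]
    rw [card_filter_fst_eq_and (fun a => gadgetLeft a = v), card_gadgetLeft]
    exact hdeg v
  · rintro ⟨i, v⟩
    simp only [Prod.mk.injEq]
    rw [card_filter_fst_eq_and (fun a => gadgetRight a = v), card_gadgetRight]
    exact hdeg v
  · refine ⟨(0, .inr (.inr ())), ?_⟩
    simp only [Prod.mk.injEq]
    rw [card_filter_fst_eq_and (fun a => gadgetLeft a = .inr (.inr ())), card_gadgetLeft]
    rfl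
  · rintro ⟨i, a⟩ ⟨j, b⟩ hc h
    simp only [Prod.mk.injEq] at hc h ⊢
    obtain rfl : i = j := by rcases h with h | h <;> exact h.1
    refine ⟨rfl, gadgetColor_proper hσ hτ ?_ (h.imp And.right And.right)⟩
    exact Option.map_injective (Prod.mk_right_injective i) hc
  · rintro (_ | ⟨i, z⟩)
    · have hsub : (Finset.univ : Finset (Fin (d + 2))).image
          (fun i => (i, (.inr (.inr (.inr ())) : GadgetEdge Z d))) ⊆
          ({a | (gadgetColor σ τ a.2).map (Prod.mk a.1) = none} :
            Finset (Fin (d + 2) × GadgetEdge Z d)) := by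
        intro a ha
        obtain ⟨i, -, rfl⟩ := Finset.mem_image.1 ha
        simp [gadgetColor]
      refine le_trans ?_ (Finset.card_le_card hsub)
      rw [Finset.card_image_of_injective _ (Prod.mk_left_injective _)]
      simp
    · have h := hcol z
      rw [← card_gadgetColor_some,
        ← card_filter_fst_eq_and (fun a => gadgetColor σ τ a = some z) i] at h
      refine h.trans (Finset.card_le_card fun a ha => ?_)
      simp only [Finset.mem_filter, Finset.mem_univ, true_and] at ha ⊢
      simp [ha]
  · intro f hf hl hr
    have hprivate (i : Fin (d + 2)) (z : Z) : (f (some (i, z))).1 = i ∧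
        gadgetColor σ τ (f (some (i, z))).2 = some z := by
      obtain ⟨w, hw, h⟩ := Option.map_eq_some_iff.1 (hf (some (i, z)))
      simp only [Prod.mk.injEq] at h
      exact ⟨h.1, h.2 ▸ hw⟩
    have hhub : (f none).2 = .inr (.inr (.inr ())) := by
      have h := Option.map_eq_none_iff.1 (hf none)
      rcases hfn : (f none).2 with p | s | t | u <;> simp_all [gadgetColor]
    set i := (f none).1
    obtain ⟨z, hz⟩ := gadget_blocks (sum_zmod_ne_zero k) σ τ (fun z => (f (some (i, z))).2)
      (fun z => (hprivate i z).2)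
      (fun a b hab => by
        simpa using hl (a₁ := some (i, a)) (a₂ := some (i, b))
          (Prod.ext ((hprivate i a).1.trans (hprivate i b).1.symm) hab))
      (fun a b hab => by
        simpa using hr (a₁ := some (i, a)) (a₂ := some (i, b))
          (Prod.ext ((hprivate i a).1.trans (hprivate i b).1.symm) hab))
    rcases hz with hz | hz
    · have := hl (a₁ := some (i, z)) (a₂ := none)
        (Prod.ext (hprivate i z).1 (hz.trans (congrArg gadgetLeft hhub).symm))
      simp at this
    · have := hr (a₁ := some (i, z)) (a₂ := none)
        (Prod.ext (hprivate i z).1 (hz.trans (congrArg gadgetRight hhub).symm))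
      simp at this
end

section
/- For every integer Δ ≥ 3 with Δ ≡ 0 (mod 4) or Δ ≡ 3 (mod 4), there exist a multigraph G with maximum degree Δ and chromatic index Δ and a proper edge-coloring of G into color classes E_1, …, E_n such that |E_i| ≥ Δ + 2 for every i and G has no full rainbow matching with respect to E_1, …, E_n. -/
open Finset

/-- The three perfect matchings of `K₄` on the vertex set `Bool × Bool`: the two edges of the
matching `s` are the fibres of `sideBit s`. -/
def sideBit (s : Fin 3) (v : Bool × Bool) : Bool :=
  if s = 0 then v.1 else if s = 1 then v.2 else xor v.1 v.2

lemma card_sideBit_fiber (s : Fin 3) (h : Bool) :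
    (univ.filter fun v => sideBit s v = h).card = 2 := by
  revert s h; decide

lemma exists_sideBit_eq_eq (s s' : Fin 3) (h h' : Bool) (hs : s ≠ s' ∨ h = h') :
    ∃ v, sideBit s v = h ∧ sideBit s' v = h' := by
  revert s s' h h'; decide

/-- The edge `(x, h, t)` of a disjoint union, indexed by `X`, of copies of `K₄` with multiple
edges: `t` indexes the parallel edges, and `σ t` is the perfect matching it belongs to. -/
def gadgetEdge {X T : Type} [Fintype X] [DecidableEq X] (σ : T → Fin 3) (a : X × Bool × T) :
    Finset (X × (Bool × Bool)) :=
  univ.filter fun w => w.1 = a.1 ∧ sideBit (σ a.2.2) w.2 = a.2.1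

section Gadget

variable {X T : Type} [Fintype X] [DecidableEq X] (σ : T → Fin 3)

lemma card_gadgetEdge (a : X × Bool × T) : (gadgetEdge σ a).card = 2 := by
  have h : gadgetEdge σ a = {a.1} ×ˢ (univ.filter fun v => sideBit (σ a.2.2) v = a.2.1) := by
    ext w; simp only [gadgetEdge, mem_filter, mem_univ, true_and, mem_product, mem_singleton]
  rw [h, card_product, card_sideBit_fiber, card_singleton]

lemma disjoint_gadgetEdge_iff (a b : X × Bool × T) :
    Disjoint (gadgetEdge σ a) (gadgetEdge σ b) ↔
      (a.1 = b.1 → σ a.2.2 = σ b.2.2 ∧ a.2.1 ≠ b.2.1) := by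
  constructor
  · intro hd hx
    by_contra hc
    obtain ⟨v, hv, hv'⟩ := exists_sideBit_eq_eq (σ a.2.2) (σ b.2.2) a.2.1 b.2.1 (by tauto)
    exact disjoint_left.1 hd (show (a.1, v) ∈ _ by simp [gadgetEdge, hv])
      (by simp [gadgetEdge, hv', hx])
  · intro h
    refine disjoint_left.2 fun w hw hw' => ?_
    simp only [gadgetEdge, mem_filter, mem_univ, true_and] at hw hw'
    obtain ⟨hs, hh⟩ := h (hw.1.symm.trans hw'.1)
    exact hh (by rw [← hw.2, ← hw'.2, hs])

lemma card_filter_mem_gadgetEdge [Fintype T] (w : X × (Bool × Bool)) :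
    (univ.filter fun a => w ∈ gadgetEdge σ a).card = Fintype.card T := by
  rw [← Finset.card_univ]
  refine (card_bij (fun t _ => (w.1, sideBit (σ t) w.2, t)) ?_ ?_ ?_).symm
  · intro t _; simp [gadgetEdge]
  · intro t _ t' _ h; simpa using congrArg (fun a => a.2.2) h
  · rintro ⟨x, h, t⟩ ha
    simp only [gadgetEdge, mem_filter, mem_univ, true_and] at ha
    exact ⟨t, mem_univ _, by rw [ha.1, ha.2]⟩

end Gadget

/-- A disjoint union of copies of `K₄` with multiple edges in which the classes of the colouring
`col` have size at least `Δ + 2` yields the required multigraph, as soon as there is no choice of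
one edge of each colour whose members in a common copy are opposite edges. -/
theorem exists_multigraph_of_gadgets {X T κ : Type} [Fintype X] [DecidableEq X] [Nonempty X]
    [Fintype T] [Fintype κ] [DecidableEq κ] (Δ : ℕ) (hT : Fintype.card T = Δ)
    (σ : T → Fin 3) (col : X × Bool × T → κ)
    (hcol : ∀ x h t h' t', col (x, h, t) = col (x, h', t') → σ t = σ t' ∧ (h = h' → t = t'))
    (hsize : ∀ i, ∃ (W : Type) (_ : Fintype W) (g : W → X × Bool × T),
      Δ + 2 ≤ Fintype.card W ∧ Function.Injective g ∧ ∀ w, col (g w) = i)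
    (hno : ∀ f : κ → X × Bool × T, (∀ i, col (f i) = i) →
      (∀ i j, i ≠ j → (f i).1 = (f j).1 →
        σ (f i).2.2 = σ (f j).2.2 ∧ (f i).2.1 ≠ (f j).2.1) → False) :
    ∃ (N M n : ℕ) (E : Fin M → Finset (Fin N)) (c : Fin M → Fin n),
      (∀ a, (E a).card = 2) ∧
      (∀ v, mhDeg E v ≤ Δ) ∧ (∃ v, mhDeg E v = Δ) ∧
      isChromaticIndex E Δ ∧
      properColoring E c ∧
      (∀ i : Fin n, Δ + 2 ≤ classSize c i) ∧
      ¬ hasFullRainbowMatching E c := by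
  classical
  let eV := Fintype.equivFin (X × (Bool × Bool))
  let eE := Fintype.equivFin (X × Bool × T)
  let eC := Fintype.equivFin κ
  let eT := Fintype.equivFinOfCardEq hT
  set E : Fin _ → Finset (Fin _) :=
    fun a => (gadgetEdge σ (eE.symm a)).map eV.toEmbedding with hE
  have hdisj : ∀ a b, Disjoint (E a) (E b) ↔ ((eE.symm a).1 = (eE.symm b).1 →
      σ (eE.symm a).2.2 = σ (eE.symm b).2.2 ∧ (eE.symm a).2.1 ≠ (eE.symm b).2.1) := by
    intro a b
    rw [hE, disjoint_map, disjoint_gadgetEdge_iff]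
  have hdeg : ∀ v, mhDeg E v = Δ := by
    intro v
    rw [← hT, ← card_filter_mem_gadgetEdge σ (eV.symm v)]
    refine card_equiv eE.symm fun a => ?_
    simp only [mem_filter, mem_univ, true_and, hE]
    rw [← eV.apply_symm_apply v]
    simp
  let v₀ : Fin _ := eV (Classical.arbitrary X, (true, true))
  refine ⟨_, _, _, E, fun a => eC (col (eE.symm a)), fun a => ?_, fun v => (hdeg v).le,
    ⟨v₀, hdeg v₀⟩, ⟨⟨fun a => eT (eE.symm a).2.2, ?_⟩, ?_⟩, ?_, fun i => ?_, ?_⟩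
  · rw [hE, card_map, card_gadgetEdge]
  · intro a b hab ht
    rw [hdisj]
    have ht := eT.injective ht
    refine fun hx => ⟨by rw [ht], fun hh => hab (eE.symm.injective ?_)⟩
    exact Prod.ext hx (Prod.ext hh ht)
  · rintro k ⟨c, hc⟩
    refine (hdeg v₀).ge.trans (le_of_le_of_eq (b := (univ : Finset (Fin k)).card) ?_ (by simp))
    refine card_le_card_of_injOn c (fun _ _ => mem_coe.2 (mem_univ _)) ?_
    intro a ha b hb hab
    by_contra hne
    simp only [coe_filter, mem_univ, true_and, Set.mem_ofPred_eq] at ha hb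
    exact disjoint_left.1 (hc a b hne hab) ha hb
  · intro a b hab hc
    rw [hdisj]
    have hc := eC.injective hc
    intro hx
    have hab' : eE.symm a ≠ eE.symm b := fun h => hab (eE.symm.injective h)
    generalize eE.symm a = a' at *
    generalize eE.symm b = b' at *
    obtain ⟨x, h, t⟩ := a'
    obtain ⟨x', h', t'⟩ := b'
    obtain rfl : x = x' := hx
    obtain ⟨h1, h2⟩ := hcol x h t h' t' hc
    refine ⟨h1, fun hh => hab' ?_⟩
    obtain rfl : h = h' := hh
    rw [h2 rfl]
  · obtain ⟨W, _, g, hW, hg, hgc⟩ := hsize (eC.symm i)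
    refine hW.trans ?_
    rw [← Finset.card_univ]
    refine card_le_card_of_injOn (fun w => eE (g w)) (fun w _ => ?_)
      (fun w _ w' _ h => hg (eE.injective h))
    simp [hgc]
  · rintro ⟨f, hf, hfd⟩
    refine hno (fun i => eE.symm (f (eC i))) (fun i => eC.injective (hf _)) fun i j hij => ?_
    exact (hdisj _ _).1 (hfd _ _ (eC.injective.ne hij))

lemma succ_le_card_image_of_fibers {α β : Type} [Fintype α] [DecidableEq β] (q : ℕ)
    (hα : Fintype.card α = 2 * q + 1) (F : α → β) (b : α → Bool)
    (hF : ∀ x y, x ≠ y → F x = F y → b x ≠ b y) : q + 1 ≤ (univ.image F).card := by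
  classical
  have h : (univ : Finset α).card ≤ 2 * (univ.image F).card := by
    refine card_le_mul_card_image univ 2 fun y _ => ?_
    rw [← Fintype.card_bool, ← Finset.card_univ (α := Bool)]
    refine card_le_card_of_injOn b (fun _ _ => mem_coe.2 (mem_univ _)) ?_
    intro u hu v hv huv
    by_contra hne
    simp only [coe_filter, mem_univ, true_and, Set.mem_ofPred_eq] at hu hv
    exact hF u v hne (hu.trans hv.symm) huv
  rw [Finset.card_univ, hα] at h
  omega

/-- Colours for odd `Δ`: block `i` owns the colours `inl (i, ·)`; two further colours are shared
by all blocks. -/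
abbrev OddColor (q : ℕ) : Type := (ZMod (2 * q + 5) × (Bool ⊕ Fin (2 * q + 1))) ⊕ Bool

/-- Matchings for odd `Δ`. -/
def oddSide (q : ℕ) : Bool ⊕ Fin (2 * q + 1) → Fin 3
  | .inl false => 0
  | .inl true => 1
  | .inr _ => 2

/-- The colouring for odd `Δ`: the copy `(i, 0)` links the block `i` to the block `i - 1`, and
contains an edge of both shared colours. -/
def oddCol (q : ℕ) :
    (ZMod (2 * q + 5) × Fin (q + 3)) × Bool × (Bool ⊕ Fin (2 * q + 1)) → OddColor q
  | ((i, t), h, .inl false) =>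
      if t = 0 then if h then .inr false else .inl (i - 1, .inl false) else .inl (i, .inl false)
  | ((i, t), h, .inl true) => if t = 0 ∧ h then .inr true else .inl (i, .inl true)
  | ((i, _), _, .inr u) => .inl (i, .inr u)

lemma oddCol_eq_first {q : ℕ} {k : ZMod (2 * q + 5)}
    {a : (ZMod (2 * q + 5) × Fin (q + 3)) × Bool × (Bool ⊕ Fin (2 * q + 1))}
    (ha : oddCol q a = .inl (k, .inl false)) :
    a.2.2 = .inl false ∧ (a.1 = (k + 1, 0) ∨ a.1.1 = k ∧ a.1.2 ≠ 0) := by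
  obtain ⟨⟨i, t⟩, h, (_ | _) | u'⟩ := a <;> simp only [oddCol] at ha <;>
    (try split_ifs at ha) <;> simp_all [sub_eq_iff_eq_add]

lemma oddCol_eq_second {q : ℕ} {k : ZMod (2 * q + 5)}
    {a : (ZMod (2 * q + 5) × Fin (q + 3)) × Bool × (Bool ⊕ Fin (2 * q + 1))}
    (ha : oddCol q a = .inl (k, .inl true)) :
    a.2.2 = .inl true ∧ a.1.1 = k := by
  obtain ⟨⟨i, t⟩, h, (_ | _) | u'⟩ := a <;> simp only [oddCol] at ha <;>
    (try split_ifs at ha) <;> simp_all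

lemma oddCol_eq_third {q : ℕ} {k : ZMod (2 * q + 5)} {u : Fin (2 * q + 1)}
    {a : (ZMod (2 * q + 5) × Fin (q + 3)) × Bool × (Bool ⊕ Fin (2 * q + 1))}
    (ha : oddCol q a = .inl (k, .inr u)) :
    a.2.2 = .inr u ∧ a.1.1 = k := by
  obtain ⟨⟨i, t⟩, h, (_ | _) | u'⟩ := a <;> simp only [oddCol] at ha <;>
    (try split_ifs at ha) <;> simp_all

lemma oddCol_eq_shared {q : ℕ} {b : Bool}
    {a : (ZMod (2 * q + 5) × Fin (q + 3)) × Bool × (Bool ⊕ Fin (2 * q + 1))}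
    (ha : oddCol q a = .inr b) :
    a.2.2 = .inl b ∧ a.1.2 = 0 := by
  obtain ⟨⟨i, t⟩, h, (_ | _) | u'⟩ := a <;> simp only [oddCol] at ha <;>
    (try split_ifs at ha) <;> simp_all

theorem exists_multigraph_of_odd (q : ℕ) :
    ∃ (N M n : ℕ) (E : Fin M → Finset (Fin N)) (c : Fin M → Fin n),
      (∀ a, (E a).card = 2) ∧
      (∀ v, mhDeg E v ≤ 2 * q + 3) ∧ (∃ v, mhDeg E v = 2 * q + 3) ∧
      isChromaticIndex E (2 * q + 3) ∧
      properColoring E c ∧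
      (∀ i : Fin n, 2 * q + 3 + 2 ≤ classSize c i) ∧
      ¬ hasFullRainbowMatching E c := by
  refine exists_multigraph_of_gadgets (2 * q + 3) (by simp; omega) (oddSide q) (oddCol q)
    ?_ ?_ ?_
  · rintro ⟨i, t⟩ h ((_ | _) | u) h' ((_ | _) | u') <;> simp only [oddCol, oddSide] <;>
      (try split_ifs) <;> simp_all
  · rintro (⟨i, (_ | _) | u⟩ | _ | _)
    · refine ⟨Option (Bool × Fin (q + 2)), inferInstance, fun w => w.elim
        ((i + 1, 0), false, .inl false) fun p => ((i, p.2.succ), p.1, .inl false), ?_, ?_, ?_⟩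
      · simp; omega
      · rintro (_ | ⟨h, t⟩) (_ | ⟨h', t'⟩) <;> simp [eq_comm, Fin.succ_ne_zero] <;> tauto
      · rintro (_ | ⟨h, t⟩) <;> simp [oddCol, Fin.succ_ne_zero]
    · refine ⟨Option (Bool × Fin (q + 2)), inferInstance, fun w => w.elim
        ((i, 0), false, .inl true) fun p => ((i, p.2.succ), p.1, .inl true), ?_, ?_, ?_⟩
      · simp; omega
      · rintro (_ | ⟨h, t⟩) (_ | ⟨h', t'⟩) <;> simp [eq_comm, Fin.succ_ne_zero] <;> tauto
      · rintro (_ | ⟨h, t⟩) <;> simp [oddCol, Fin.succ_ne_zero]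
    · refine ⟨Bool × Fin (q + 3), inferInstance, fun p => ((i, p.2), p.1, .inr u), ?_, ?_, ?_⟩
      · simp; omega
      · rintro ⟨h, t⟩ ⟨h', t'⟩; simp; tauto
      · rintro ⟨h, t⟩; simp [oddCol]
    · refine ⟨ZMod (2 * q + 5), inferInstance, fun i => ((i, 0), true, .inl false), ?_, ?_, ?_⟩
      · simp
      · intro i j; simp
      · intro i; simp [oddCol]
    · refine ⟨ZMod (2 * q + 5), inferInstance, fun i => ((i, 0), true, .inl true), ?_, ?_, ?_⟩
      · simp
      · intro i j; simp
      · intro i; simp [oddCol]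
  intro f hf hd
  have hA := fun k => oddCol_eq_first (hf (.inl (k, .inl false)))
  have hB := fun k => oddCol_eq_second (hf (.inl (k, .inl true)))
  have hC := fun k u => oddCol_eq_third (hf (.inl (k, .inr u)))
  have hD := fun b => oddCol_eq_shared (hf (.inr b))
  have hside : ∀ a b, (f a).1 = (f b).1 → oddSide q (f a).2.2 = oddSide q (f b).2.2 := by
    intro a b hab
    by_cases h : a = b
    · rw [h]
    · exact (hd a b h hab).1
  -- A block whose linking copy is used by its first matching must use the next linking copy.
  have hstep : ∀ k, (∃ a, (f a).1 = (k, 0) ∧ (f a).2.2 = .inl false) →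
      (f (.inl (k, .inl false))).1 = (k + 1, 0) := by
    rintro k ⟨a, ha, ha'⟩
    refine (hA k).2.resolve_right fun ⟨hk, hk0⟩ => ?_
    set S := univ.image fun u => (f (.inl (k, .inr u))).1.2 with hS
    have hcard : q + 1 ≤ S.card := by
      refine succ_le_card_image_of_fibers q (by simp) _
        (fun u => (f (.inl (k, .inr u))).2.1) fun u v huv h => (hd _ _ ?_ ?_).2
      · simpa using huv
      · exact Prod.ext ((hC k u).2.trans (hC k v).2.symm) h
    have hB0 : (f (.inl (k, .inl true))).1.2 ∉
        insert 0 (insert (f (.inl (k, .inl false))).1.2 S) := by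
      simp only [hS, mem_insert, mem_image, mem_univ, true_and, not_or, not_exists]
      refine ⟨fun h => ?_, fun h => ?_, fun u h => ?_⟩
      · have := hside (.inl (k, .inl true)) a (by rw [ha]; exact Prod.ext (hB k).2 h)
        simp [(hB k).1, ha', oddSide] at this
      · have := hside (.inl (k, .inl true)) (.inl (k, .inl false))
          (Prod.ext ((hB k).2.trans hk.symm) h)
        simp [(hB k).1, (hA k).1, oddSide] at this
      · have := hside (.inl (k, .inr u)) (.inl (k, .inl true))
          (Prod.ext ((hC k u).2.trans (hB k).2.symm) h)
        simp [(hB k).1, (hC k u).1, oddSide] at this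
    have h0 : (0 : Fin (q + 3)) ∉ insert (f (.inl (k, .inl false))).1.2 S := by
      simp only [hS, mem_insert, mem_image, mem_univ, true_and, not_or, not_exists]
      refine ⟨hk0.symm, fun u h => ?_⟩
      have := hside (.inl (k, .inr u)) a (by rw [ha]; exact Prod.ext (hC k u).2 h)
      simp [(hC k u).1, ha', oddSide] at this
    have hA0 : (f (.inl (k, .inl false))).1.2 ∉ S := by
      simp only [hS, mem_image, mem_univ, true_and, not_exists]
      intro u h
      have := hside (.inl (k, .inr u)) (.inl (k, .inl false))
          (Prod.ext ((hC k u).2.trans hk.symm) h)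
      simp [(hA k).1, (hC k u).1, oddSide] at this
    have := card_le_univ (insert (f (.inl (k, .inl true))).1.2
      (insert 0 (insert (f (.inl (k, .inl false))).1.2 S)))
    rw [card_insert_of_notMem hB0, card_insert_of_notMem h0, card_insert_of_notMem hA0,
      Fintype.card_fin] at this
    omega
  have hon : ∀ m : ℕ, ∃ a, (f a).1 = ((f (.inr false)).1.1 + m, 0) ∧ (f a).2.2 = .inl false := by
    intro m
    induction m with
    | zero => exact ⟨.inr false, Prod.ext (by simp) (hD false).2, (hD false).1⟩
    | succ m ih =>
      exact ⟨_, by rw [hstep _ ih]; push_cast; rw [add_assoc], (hA _).1⟩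
  obtain ⟨a, ha, ha'⟩ := hon ((f (.inr true)).1.1 - (f (.inr false)).1.1).val
  rw [ZMod.natCast_zmod_val, add_sub_cancel] at ha
  have := hside a (.inr true) (by rw [ha]; exact Prod.ext rfl (hD true).2.symm)
  simp [ha', (hD true).1, oddSide] at this

/-- The columns of the array of copies of `K₄` used for even `Δ`. -/
abbrev EvenColumn (q : ℕ) : Type := Option (Bool × Fin (q + 2))

/-- Colours for even `Δ`: columns own the colours `inl (j, ·)`, rows the colours `inr (i, ·)`. -/
abbrev EvenColor (q : ℕ) : Type :=
  (EvenColumn q × Option (Fin (2 * q + 1))) ⊕ (Fin (q + 3) × Fin 3)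

/-- Matchings for even `Δ`. -/
def evenSide (q : ℕ) : Option (Fin (2 * q + 1)) ⊕ Bool → Fin 3
  | .inl none => 0
  | .inl (some _) => 1
  | .inr _ => 2

/-- The row colour missing in a column. -/
def missingColor {q : ℕ} : EvenColumn q → Fin 3
  | none => 2
  | some (false, _) => 0
  | some (true, _) => 1

/-- The colouring for even `Δ`. -/
def evenCol (q : ℕ) :
    (Fin (q + 3) × EvenColumn q) × Bool × (Option (Fin (2 * q + 1)) ⊕ Bool) → EvenColor q
  | ((_, j), _, .inl u) => .inl (j, u)
  | ((i, j), _, .inr b) => .inr (i, missingColor j + if b then 2 else 1)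

theorem exists_multigraph_of_even (q : ℕ) :
    ∃ (N M n : ℕ) (E : Fin M → Finset (Fin N)) (c : Fin M → Fin n),
      (∀ a, (E a).card = 2) ∧
      (∀ v, mhDeg E v ≤ 2 * q + 4) ∧ (∃ v, mhDeg E v = 2 * q + 4) ∧
      isChromaticIndex E (2 * q + 4) ∧
      properColoring E c ∧
      (∀ i : Fin n, 2 * q + 4 + 2 ≤ classSize c i) ∧
      ¬ hasFullRainbowMatching E c := by
  have hslot : ∀ m k : Fin 3, m ≠ k → ∃ b : Bool, (m + if b then 2 else 1) = k := by decide
  refine exists_multigraph_of_gadgets (2 * q + 4) (by simp) (evenSide q) (evenCol q)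
    ?_ ?_ ?_
  · rintro ⟨i, j⟩ h ((_ | u) | b) h' ((_ | u') | b') hc <;> simp_all [evenCol, evenSide]
    intro _
    revert b b' hc
    decide
  · rintro (⟨j, u⟩ | ⟨i, k⟩)
    · refine ⟨Bool × Fin (q + 3), inferInstance, fun p => ((p.2, j), p.1, .inl u), ?_, ?_, ?_⟩
      · simp; omega
      · rintro ⟨h, t⟩ ⟨h', t'⟩; simp; tauto
      · rintro ⟨h, t⟩; simp [evenCol]
    · obtain ⟨g, hg, hgk⟩ : ∃ g : Option (Fin (q + 2)) → EvenColumn q,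
          Function.Injective g ∧ ∀ w, missingColor (g w) ≠ k := by
        match k with
        | 0 =>
          refine ⟨fun w => w.map fun t => (true, t), ?_, ?_⟩
          · rintro (_ | t) (_ | t') <;> simp
          · rintro (_ | t) <;> simp [missingColor]
        | 1 =>
          refine ⟨fun w => w.map fun t => (false, t), ?_, ?_⟩
          · rintro (_ | t) (_ | t') <;> simp
          · rintro (_ | t) <;> simp [missingColor]
        | 2 =>
          refine ⟨fun w => w.elim (some (true, 0)) fun t => some (false, t), ?_, ?_⟩
          · rintro (_ | t) (_ | t') <;> simp
          · rintro (_ | t) <;> simp [missingColor]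
      choose b hb using fun w => hslot _ _ (hgk w)
      refine ⟨Bool × Option (Fin (q + 2)), inferInstance,
        fun p => ((i, g p.2), p.1, .inr (b p.2)), ?_, ?_, ?_⟩
      · simp; omega
      · rintro ⟨h, t⟩ ⟨h', t'⟩ heq
        simp only [Prod.mk.injEq] at heq
        rw [hg heq.1.2, heq.2.1]
      · rintro ⟨h, t⟩; simp only [evenCol, hb]
  intro f hf hd
  have hcolumn : ∀ j u, (f (.inl (j, u))).2.2 = .inl u ∧ (f (.inl (j, u))).1.2 = j := by
    intro j u
    have := hf (.inl (j, u))
    generalize f (.inl (j, u)) = a at *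
    obtain ⟨⟨i, j⟩, h, u | b⟩ := a <;> simp_all [evenCol]
  have hrow : ∀ i k, evenSide q (f (.inr (i, k))).2.2 = 2 ∧ (f (.inr (i, k))).1.1 = i := by
    intro i k
    have := hf (.inr (i, k))
    generalize f (.inr (i, k)) = a at *
    obtain ⟨⟨i, j⟩, h, u | b⟩ := a <;> simp_all [evenCol, evenSide]
  have hside : ∀ a b, (f a).1 = (f b).1 → evenSide q (f a).2.2 = evenSide q (f b).2.2 := by
    intro a b hab
    by_cases h : a = b
    · rw [h]
    · exact (hd a b h hab).1
  set R := univ.image fun p : Fin (q + 3) × Fin 3 => (f (.inr p)).1 with hR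
  have hRside : ∀ x ∈ R, ∀ a, (f a).1 = x → evenSide q (f a).2.2 = 2 := by
    intro x hx a ha
    obtain ⟨⟨i, k⟩, -, rfl⟩ := mem_image.1 hx
    exact (hside _ _ ha).trans (hrow i k).1
  have hrows : ∀ i, 2 ≤ (R.filter fun x => x.1 = i).card := by
    intro i
    have hsub : (univ.image fun k => (f (.inr (i, k))).1) ⊆ R.filter fun x => x.1 = i := by
      intro x hx
      obtain ⟨k, -, rfl⟩ := mem_image.1 hx
      exact mem_filter.2 ⟨mem_image_of_mem _ (mem_univ (i, k)), (hrow i k).2⟩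
    refine (succ_le_card_image_of_fibers 1 (by simp) _
      (fun k => (f (.inr (i, k))).2.1) fun u v huv h => (hd _ _ ?_ h).2).trans
      (card_le_card hsub)
    simpa using huv
  have hcolumns : ∀ j, (R.filter fun x => x.2 = j).card ≤ 1 := by
    intro j
    set S := univ.image fun u => (f (.inl (j, some u))).1 with hS
    have hScard : q + 1 ≤ S.card := by
      refine succ_le_card_image_of_fibers q (by simp) _
        (fun u => (f (.inl (j, some u))).2.1) fun u v huv h => (hd _ _ ?_ h).2
      simpa using huv
    have hA : (f (.inl (j, none))).1 ∉ S := by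
      simp only [hS, mem_image, mem_univ, true_and, not_exists]
      intro u h
      have := hside _ _ h
      simp [hcolumn, evenSide] at this
    have hdis : Disjoint (R.filter fun x => x.2 = j) (insert (f (.inl (j, none))).1 S) := by
      refine disjoint_left.2 fun x hx hx' => ?_
      have hx := hRside x (mem_filter.1 hx).1
      rcases mem_insert.1 hx' with h | h
      · have := hx _ h.symm
        simp [hcolumn, evenSide] at this
      · obtain ⟨u, -, h⟩ := mem_image.1 h
        have := hx _ h
        simp [hcolumn, evenSide] at this
    have hle : ((R.filter fun x => x.2 = j) ∪ insert (f (.inl (j, none))).1 S).card ≤ q + 3 := by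
      refine le_of_le_of_eq (b := (univ : Finset (Fin (q + 3))).card) ?_ (by simp)
      refine card_le_card_of_injOn Prod.fst (fun _ _ => mem_coe.2 (mem_univ _)) ?_
      have hj : ∀ x ∈ (R.filter fun x => x.2 = j) ∪ insert (f (.inl (j, none))).1 S,
          x.2 = j := by
        intro x hx
        rcases mem_union.1 hx with h | h
        · exact (mem_filter.1 h).2
        · rcases mem_insert.1 h with rfl | h
          · exact (hcolumn j none).2
          · obtain ⟨u, -, rfl⟩ := mem_image.1 h
            exact (hcolumn j _).2
      intro x hx y hy hxy
      exact Prod.ext hxy ((hj x hx).trans (hj y hy).symm)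
    rw [card_union_of_disjoint hdis, card_insert_of_notMem hA] at hle
    omega
  have h₁ : (univ : Finset (Fin (q + 3))).card * 2 ≤ R.card := by
    rw [card_eq_sum_card_fiberwise (f := Prod.fst) (t := univ) (fun _ _ => mem_coe.2 (mem_univ _))]
    exact card_nsmul_le_sum _ _ _ fun i _ => hrows i
  have h₂ : R.card ≤ (univ : Finset (EvenColumn q)).card * 1 := by
    rw [card_eq_sum_card_fiberwise (f := Prod.snd) (t := univ) (fun _ _ => mem_coe.2 (mem_univ _))]
    exact sum_le_card_nsmul _ _ _ fun j _ => hcolumns j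
  have := h₁.trans h₂
  simp only [Finset.card_univ, Fintype.card_fin, Fintype.card_option, Fintype.card_prod,
    Fintype.card_bool] at this
  omega

/-- For every `Δ ≥ 3` with `Δ ≡ 0` or `3 (mod 4)` there is a properly edge-colored multigraph
with maximum degree `Δ` and chromatic index `Δ`, all color classes of size at least `Δ + 2`,
and no full rainbow matching. -/
theorem stmt7 (Δ : ℕ) (hΔ : 3 ≤ Δ) (hmod : Δ % 4 = 0 ∨ Δ % 4 = 3) :
    ∃ (N M n : ℕ) (E : Fin M → Finset (Fin N)) (c : Fin M → Fin n),
      (∀ a, (E a).card = 2) ∧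
      (∀ v, mhDeg E v ≤ Δ) ∧ (∃ v, mhDeg E v = Δ) ∧
      isChromaticIndex E Δ ∧
      properColoring E c ∧
      (∀ i : Fin n, Δ + 2 ≤ classSize c i) ∧
      ¬ hasFullRainbowMatching E c := by
  obtain h | h := Nat.mod_two_eq_zero_or_one Δ
  · obtain ⟨q, rfl⟩ : ∃ q, Δ = 2 * q + 4 := ⟨Δ / 2 - 2, by omega⟩
    exact exists_multigraph_of_even q
  · obtain ⟨q, rfl⟩ : ∃ q, Δ = 2 * q + 3 := ⟨Δ / 2 - 1, by omega⟩
    exact exists_multigraph_of_odd q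
end
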